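/- Let O be a W-orbit in ℝ^r and t ∈ T_O. For every y ∈ O and 1 ≤ i ≤ r, Y_i^O(x^y) − γ_i^O(y)·x^y ∈ span_F{x^{y'} : y' < y}; that is, Y_i^O(x^y) is a quasi-polynomial of degree y with leading coefficient γ_i^O(y) = ((g_y(𝔰^O·t))_i)^{−1}. -/

import Mathlib

open scoped Classical

noncomputable section

namespace QP

/-! ### The space of quasi-polynomials -/

/-- Euclidean space `ℝ^r`. -/
abbrev E (r : ℕ) := Fin r → ℝ

variable (F : Type*) [Field F] [CharZero F] (r : ℕ)

/-- The algebra of quasi-polynomials `F[ℝ^r]`: the group algebra of `(ℝ^r,+)` over `F`. -/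
abbrev QA := AddMonoidAlgebra F (E r)

/-- The quasi-monomial `x^y`. -/
def X (y : E r) : QA F r := AddMonoidAlgebra.single y 1

/-- The `i`-th coordinate of a vector (`1`-based). -/
def cd (y : E r) (i : ℕ) : ℝ := ∑ m : Fin r, if (m : ℕ) + 1 = i then y m else 0

/-- The standard basis vector `ε_i` (`1`-based). -/
def epsV (i : ℕ) : E r := fun m => if (m : ℕ) + 1 = i then 1 else 0

/-- The standard basis vector (`0`-based). -/
def eV (m : Fin r) : E r := fun n => if n = m then 1 else 0

/-- The Euclidean inner product on `ℝ^r`. -/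
def ip (v y : E r) : ℝ := ∑ m : Fin r, v m * y m

/-- An integral vector regarded as an element of `ℝ^r`. -/
def zc (lam : Fin r → ℤ) : E r := fun m => (lam m : ℝ)

/-- The simple reflections of the hyperoctahedral group `W₀ = S_r ⋉ (±1)^r` (`1`-based):
for `1 ≤ i < r`, `sW i` interchanges the `i`-th and `(i+1)`-st coordinates, and
`sW r` negates the last coordinate. -/
def sW (i : ℕ) (y : E r) : E r := fun m =>
  if i = r then (if (m : ℕ) + 1 = r then -y m else y m)
  else if (m : ℕ) + 1 = i then cd r y (i + 1)
  else if (m : ℕ) = i then cd r y i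
  else y m

/-- `s_{ε₁} = s₁⋯s_{r-1} s_r s_{r-1}⋯s₁`: negation of the first coordinate. -/
def sEps1 (y : E r) : E r := fun m => if (m : ℕ) = 0 then -y m else y m

/-- The affine simple reflection `s₀ = τ(ε₁) s_{ε₁} : y ↦ (1 - y₁, y₂, …, y_r)`, together
with `genF j = sW j` for `1 ≤ j ≤ r`: the Coxeter generators of the affine Weyl group
`W = W₀ ⋉ ℤ^r`. -/
def genF (j : ℕ) (y : E r) : E r :=
  if j = 0 then fun m => if (m : ℕ) = 0 then 1 - y m else y m
  else sW r j y

/-- The action of the word `s_{j₁} ⋯ s_{j_ℓ}` on `ℝ^r`. -/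
def wordAct (l : List ℕ) (y : E r) : E r := l.foldr (genF r) y

/-- The closure of the fundamental alcove
`C₊ = {y : 0 < y_r < ⋯ < y₁ < 1/2}`. -/
def CplusCl : Set (E r) :=
  {y | (∀ i j : Fin r, i ≤ j → y j ≤ y i) ∧ ∀ m : Fin r, 0 ≤ y m ∧ y m ≤ 1 / 2}

/-- The `W`-orbit of a point of `ℝ^r`. -/
def orbit (y : E r) : Set (E r) :=
  {z | ∃ l : List ℕ, (∀ a ∈ l, a ≤ r) ∧ wordAct r l y = z}

/-- `O` is a `W`-orbit in `ℝ^r`. -/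
def IsOrbit (O : Set (E r)) : Prop := ∃ y, O = orbit r y

/-- `c^𝒪`: the unique point of the orbit `O` lying in the closed fundamental alcove. -/
def cpt (O : Set (E r)) : E r :=
  if h : ∃ c, c ∈ O ∧ c ∈ CplusCl r then h.choose else 0

/-- The length of an element of the affine Weyl group `W` (as a map on `ℝ^r`). -/
def wlen (g : E r → E r) : ℕ :=
  sInf {n | ∃ l : List ℕ, (∀ a ∈ l, a ≤ r) ∧ l.length = n ∧ (fun y => wordAct r l y) = g}

/-- A choice of a shortest word `l` whose inverse maps `y` into the closed alcove;
the corresponding element of `W` is `g_y`. -/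
def gW (y : E r) : List ℕ :=
  if h : ∃ l : List ℕ, (∀ a ∈ l, a ≤ r) ∧ wordAct r l.reverse y ∈ CplusCl r ∧
      ∀ l' : List ℕ, (∀ a ∈ l', a ≤ r) → wordAct r l'.reverse y ∈ CplusCl r →
        l.length ≤ l'.length
  then h.choose else []

/-- `g_y`, the unique shortest element of `W` with `g_y⁻¹ y` in the closed alcove. -/
def gfun (y : E r) : E r → E r := fun z => wordAct r (gW r y) z

/-- The Bruhat order on `(W, {s₀,…,s_r})`, via the subword characterisation. -/
def bruhatLE (u v : E r → E r) : Prop :=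
  ∃ l : List ℕ, (∀ a ∈ l, a ≤ r) ∧ (fun z => wordAct r l z) = v ∧ l.length = wlen r v ∧
    ∃ l' : List ℕ, l'.Sublist l ∧ (fun z => wordAct r l' z) = u ∧ l'.length = wlen r u

/-- The partial order on `ℝ^r`: `y' ≤ y` iff `y'` and `y` lie in the same `W`-orbit and
`g_{y'} ≤_B g_y` in the Bruhat order. -/
def qle (y' y : E r) : Prop :=
  (∃ l : List ℕ, (∀ a ∈ l, a ≤ r) ∧ wordAct r l y = y') ∧ bruhatLE r (gfun r y') (gfun r y)

/-- Strict version of `qle`. -/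
def qlt (y' y : E r) : Prop := qle r y' y ∧ y' ≠ y

/-- The `F`-linear operator on `F[ℝ^r]` determined by its values on the quasi-monomials. -/
def mkOp (Ψ : E r → QA F r) : Module.End F (QA F r) :=
  Finsupp.linearCombination F Ψ ∘ₗ (AddMonoidAlgebra.coeffLinearEquiv F).toLinearMap

/-- `F[O] = span_F {x^y : y ∈ O}`. -/
def FO (O : Set (E r)) : Submodule F (QA F r) :=
  Submodule.span F {p | ∃ y ∈ O, p = X F r y}

/-- The Laurent polynomial subalgebra `F[ℤ^r] = span_F {x^μ : μ ∈ ℤ^r}`. -/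
def Lspan : Submodule F (QA F r) :=
  Submodule.span F {p | ∃ lam : Fin r → ℤ, p = X F r (zc r lam)}

/-- `span_F {x^{y'} : y' < y}`. -/
def ltSpan (y : E r) : Submodule F (QA F r) :=
  Submodule.span F {p | ∃ y', qlt r y' y ∧ p = X F r y'}

/-! ### Floors and indicator/sign functions -/

/-- the largest even integer `≤ z` -/
def floorE (z : ℝ) : ℤ := 2 * ⌊z / 2⌋
/-- the largest odd integer `≤ z` -/
def floorO (z : ℝ) : ℤ := 2 * ⌊(z + 1) / 2⌋ - 1
/-- indicator of `ℤ ⊆ ℝ` -/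
def chiZ (z : ℝ) : ℕ := if ∃ n : ℤ, z = n then 1 else 0
/-- indicator of the even integers -/
def chiE (z : ℝ) : ℕ := if ∃ n : ℤ, z = 2 * n then 1 else 0
/-- indicator of the odd integers -/
def chiO (z : ℝ) : ℕ := if ∃ n : ℤ, z = 2 * n + 1 then 1 else 0
/-- `η_e`: `1` on even integers `≥ 2`, `-1` on even integers `≤ 0`, `0` otherwise -/
def etaE (z : ℝ) : ℤ := if ∃ n : ℤ, z = 2 * n then (if 2 ≤ z then 1 else -1) else 0
/-- `η_o`: `1` on odd integers `≥ 1`, `-1` on odd integers `≤ -1`, `0` otherwise -/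
def etaO (z : ℝ) : ℤ := if ∃ n : ℤ, z = 2 * n + 1 then (if 1 ≤ z then 1 else -1) else 0
/-- `η = η_e + η_o` -/
def eta (z : ℝ) : ℤ := etaE z + etaO z

/-- `geomS c v m` is the truncated geometric series `(1 - (c·x^v)^m)/(1 - c·x^v)`,
a genuine element of `F[ℝ^r]`; it is the unique element with
`(1 - c·x^v) * geomS c v m = 1 - c^m·x^{m v}`. -/
def geomS (c : F) (v : E r) (m : ℤ) : QA F r :=
  if 0 ≤ m then ∑ t ∈ Finset.range m.toNat, c ^ (t : ℤ) • X F r ((t : ℝ) • v)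
  else -∑ t ∈ Finset.range (-m).toNat, c ^ (-(t : ℤ) - 1) • X F r ((-(t : ℝ) - 1) • v)

/-! ### Truncated divided difference operators and Demazure–Lusztig operators -/

/-- `∇_i(x^y) = ((1 - (x_{i+1}/x_i)^{⌊y_i - y_{i+1}⌋})/(1 - x_i/x_{i+1}))·x^y`. -/
def nablaIel (i : ℕ) (y : E r) : QA F r :=
  geomS F r 1 (epsV r i - epsV r (i + 1)) (-⌊cd r y i - cd r y (i + 1)⌋) * X F r y

/-- `∇_r^e(x^y) = ((1 - x_r^{-⌊2y_r⌋_e})/(1 - x_r^2))·x^y`. -/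
def nablaReEl (y : E r) : QA F r :=
  geomS F r 1 ((2 : ℝ) • epsV r r) (-floorE (2 * cd r y r) / 2) * X F r y

/-- `∇_r^o(x^y) = ((x_r - x_r^{-⌊2y_r⌋_o})/(1 - x_r^2))·x^y`. -/
def nablaRoEl (y : E r) : QA F r :=
  X F r (epsV r r) *
    geomS F r 1 ((2 : ℝ) • epsV r r) ((-floorO (2 * cd r y r) - 1) / 2) * X F r y

def nablaIop (i : ℕ) : Module.End F (QA F r) := mkOp F r (nablaIel F r i)
def nablaReOp : Module.End F (QA F r) := mkOp F r (nablaReEl F r)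
def nablaRoOp : Module.End F (QA F r) := mkOp F r (nablaRoEl F r)

/-- The value of the truncated Demazure–Lusztig operator `T_i` (`1 ≤ i ≤ r`) on `x^y`. -/
def Tel (k kr ur : F) (i : ℕ) (y : E r) : QA F r :=
  if i = r then
    (kr ^ chiE (2 * cd r y r) * ur ^ chiO (2 * cd r y r)) • X F r (sW r r y)
      + (kr - kr⁻¹) • nablaReEl F r y + (ur - ur⁻¹) • nablaRoEl F r y
  else
    k ^ chiZ (cd r y i - cd r y (i + 1)) • X F r (sW r i y)
      + (k - k⁻¹) • nablaIel F r i y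

/-- The truncated Demazure–Lusztig operators `T_1, …, T_r` on `F[ℝ^r]`. -/
def Top (k kr ur : F) (i : ℕ) : Module.End F (QA F r) := mkOp F r (Tel F r k kr ur i)

/-! ### The torus and the affine generator -/

/-- `t^{ε_i}`: the `i`-th coordinate (`1`-based) of an element of the torus `T = (Fˣ)^r`. -/
def tcU (t : Fin r → Fˣ) (i : ℕ) : Fˣ := ∏ m : Fin r, if (m : ℕ) + 1 = i then t m else 1

/-- `t^λ` for `λ ∈ ℤ^r`. -/
def upow (t : Fin r → Fˣ) (lam : Fin r → ℤ) : Fˣ := ∏ m : Fin r, t m ^ lam m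

/-- `t^v` for a vector `v` with integral entries (entries read off via the floor). -/
def upowR (t : Fin r → Fˣ) (v : E r) : Fˣ := ∏ m : Fin r, t m ^ ⌊v m⌋

/-- The `W`-action on the torus `T = (Fˣ)^r`: for `g = τ(λ)w₀ ∈ W` (so `g y = w₀ y + λ`),
`(g t)_m = q^{λ_m} · t^{w₀⁻¹ ε_m}`, where `W₀` permutes and inverts coordinates and
`τ(λ) t = q^λ t`, with `q = (q^{1/2})²`. -/
def torusAct (qh : Fˣ) (g : E r → E r) (t : Fin r → Fˣ) : Fin r → Fˣ := fun m =>
  (qh * qh) ^ ⌊g 0 m⌋ * ∏ j : Fin r, t j ^ ⌊(g (eV r j) - g 0) m⌋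

/-- The action on the torus of the linear part of `g` alone (the `W₀`-action). -/
def torusAct0 (g : E r → E r) (t : Fin r → Fˣ) : Fin r → Fˣ := fun m =>
  ∏ j : Fin r, t j ^ ⌊(g (eV r j) - g 0) m⌋

/-- The simple affine roots `α₀(y) = 1 - 2y₁`, `α_i(y) = y_i - y_{i+1}` (`1 ≤ i < r`),
`α_r(y) = 2 y_r` as affine-linear functionals. -/
def alphaF (j : ℕ) (y : E r) : ℝ :=
  if j = 0 then 1 - 2 * cd r y 1
  else if j = r then 2 * cd r y r
  else cd r y j - cd r y (j + 1)

/-- `t^{α_j^∨}` where `α₀^∨ = (-ε₁, 1/2)`, `α_i^∨ = (ε_i - ε_{i+1}, 0)`, `α_r^∨ = (ε_r, 0)`. -/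
def tpowCo (qh : Fˣ) (t : Fin r → Fˣ) (j : ℕ) : Fˣ :=
  if j = 0 then qh * (tcU F r t 1)⁻¹
  else if j = r then tcU F r t r
  else tcU F r t j * (tcU F r t (j + 1))⁻¹

/-- The affine subtorus `T_𝒪 = {t ∈ T : t^{α_j^∨} = 1 whenever α_j(c^𝒪) = 0}`. -/
def TOset (qh : Fˣ) (O : Set (E r)) : Set (Fin r → Fˣ) :=
  {t | ∀ j : ℕ, j ≤ r → alphaF r j (cpt r O) = 0 → tpowCo F r qh t j = 1}

/-- `∇₀^e(x^y) = ((1 - (q^{-1/2}x₁)^{⌊-2y₁⌋_e})/(1 - q x₁^{-2}))·x^y`. -/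
def nabla0eEl (qh : F) (y : E r) : QA F r :=
  geomS F r (qh * qh) ((-2 : ℝ) • epsV r 1) (-floorE (-2 * cd r y 1) / 2) * X F r y

/-- `∇₀^o(x^y) = ((q^{1/2}x₁^{-1} - (q^{-1/2}x₁)^{⌊-2y₁⌋_o})/(1 - q x₁^{-2}))·x^y`. -/
def nabla0oEl (qh : F) (y : E r) : QA F r :=
  (qh • X F r ((-1 : ℝ) • epsV r 1)) *
    geomS F r (qh * qh) ((-2 : ℝ) • epsV r 1) ((-floorO (-2 * cd r y 1) - 1) / 2) * X F r y

/-- The value of `T₀^𝒪` on `x^y`. -/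
def T0el (qh : Fˣ) (k0 u0 : F) (t : Fin r → Fˣ) (y : E r) : QA F r :=
  (k0 ^ chiE (2 * cd r y 1) * u0 ^ chiO (2 * cd r y 1) *
      ((tcU F r (torusAct F r qh (gfun r y) t) 1 : Fˣ) : F)) • X F r (sEps1 r y)
    + (k0 - k0⁻¹) • nabla0eEl F r qh y + (u0 - u0⁻¹) • nabla0oEl F r qh y

/-- The operator `T₀^𝒪` (as a globally defined operator; on `F[𝒪]` it is the operator of
the quasi-polynomial representation). -/
def T0op (qh : Fˣ) (k0 u0 : F) (t : Fin r → Fˣ) : Module.End F (QA F r) :=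
  mkOp F r (T0el F r qh k0 u0 t)

/-- The full family `T₀^𝒪, T₁, …, T_r`. -/
def Tfull (qh : Fˣ) (k0 u0 k kr ur : F) (t : Fin r → Fˣ) (j : ℕ) : Module.End F (QA F r) :=
  if j = 0 then T0op F r qh k0 u0 t else Top F r k kr ur j

/-- The Hecke parameter `k_j` (`k₀`, `k` or `k_r`). -/
def kpar (k0 k kr : F) (j : ℕ) : F := if j = 0 then k0 else if j = r then kr else k

/-- `(T_j^𝒪)⁻¹ = T_j^𝒪 - k_j + k_j⁻¹` (the inverse on `F[𝒪]`, by the Hecke relation). -/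
def TfullInv (qh : Fˣ) (k0 u0 k kr ur : F) (t : Fin r → Fˣ) (j : ℕ) : Module.End F (QA F r) :=
  Tfull F r qh k0 u0 k kr ur t j - (kpar F r k0 k kr j - (kpar F r k0 k kr j)⁻¹) • 1

/-- The word `0, 1, …, r-1, r, r-1, …, i` used in the definition of `Y_i^𝒪`. -/
def Ylist (i : ℕ) : List ℕ :=
  0 :: (((List.range (r - 1)).map (· + 1)) ++ [r] ++ ((List.range (r - i)).map fun m => r - 1 - m))

/-- The commuting operators
`Y_i^𝒪 = (T_{i-1}^𝒪)⁻¹⋯(T₁^𝒪)⁻¹ · T₀^𝒪 · T₁^𝒪⋯T_{r-1}^𝒪 · T_r^𝒪 · T_{r-1}^𝒪⋯T_i^𝒪`. -/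
def Yop (qh : Fˣ) (k0 u0 k kr ur : F) (t : Fin r → Fˣ) (i : ℕ) : Module.End F (QA F r) :=
  ((((List.range (i - 1)).map (· + 1)).reverse.map (TfullInv F r qh k0 u0 k kr ur t)).prod) *
    (((Ylist r i).map (Tfull F r qh k0 u0 k kr ur t)).prod)

/-! ### The base points `𝔰^𝒪`, `𝔰_y` and the spectrum -/

/-- `n_i^𝒪` (with `c = c^𝒪`), resp. `m_i(y)` (with `c = y`). -/
def nO (c : E r) (m : Fin r) : ℤ :=
  (∑ j : Fin r, if m < j then eta (c m - c j) + eta (c m + c j) else 0) +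
    ∑ j : Fin r, if j < m then eta (c j + c m) - eta (c j - c m) else 0

/-- The base point `𝔰^𝒪 ∈ T`. -/
def sOtor (k0 u0 k kr ur : Fˣ) (O : Set (E r)) : Fin r → Fˣ := fun m =>
  (k0 * kr) ^ (-(chiE (2 * cpt r O m) : ℤ)) * (u0 * ur) ^ (chiO (2 * cpt r O m) : ℤ) *
    k ^ nO r (cpt r O) m

/-- The eigenvalue `γ_i^𝒪(y) = ((g_y(𝔰^𝒪·t))_i)⁻¹`. -/
def gammaO (qh k0 u0 k kr ur : Fˣ) (O : Set (E r)) (t : Fin r → Fˣ) (i : ℕ) (y : E r) : Fˣ :=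
  (tcU F r (torusAct F r qh (gfun r y) fun m => sOtor F r k0 u0 k kr ur O m * t m) i)⁻¹

/-- `𝔰_y ∈ T`. -/
def sfrak (k0 u0 k kr ur : Fˣ) (y : E r) : Fin r → Fˣ := fun m =>
  (k0 * kr) ^ etaE (2 * y m) * (u0 * ur) ^ etaO (2 * y m) * k ^ nO r y m

/-! ### Finite Weyl group combinatorics, positive roots -/

/-- The set of positive roots of type `C_r`. -/
def PhiPlus : Set (E r) :=
  {v | (∃ a b : Fin r, a < b ∧ v = eV r a - eV r b) ∨
       (∃ a b : Fin r, a < b ∧ v = eV r a + eV r b) ∨ ∃ a : Fin r, v = (2 : ℝ) • eV r a}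

/-- The root system of type `C_r`. -/
def Phi0 : Set (E r) := PhiPlus r ∪ {v | -v ∈ PhiPlus r}

/-- The normalisation factor `κ_w^𝒪 = ∏_{α ∈ Π(w)} 𝐤_α^{χ_e(α(c))}·𝐤_{α/2}^{-χ_o(α(c))}`,
where `Π(w) = {α ∈ Φ₀⁺ : wα ∈ -Φ₀⁺}`, `𝐤_α = 𝐤_{α/2} = k` for short roots and
`𝐤_α = k_r`, `𝐤_{α/2} = u_r` for long roots. -/
def kappaW (k kr ur : Fˣ) (w : E r → E r) (c : E r) : Fˣ :=
  (∏ p : Fin r × Fin r,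
      if p.1 < p.2 ∧ -w (eV r p.1 - eV r p.2) ∈ PhiPlus r then
        k ^ ((chiE (ip r (eV r p.1 - eV r p.2) c) : ℤ) - (chiO (ip r (eV r p.1 - eV r p.2) c) : ℤ))
      else 1) *
  (∏ p : Fin r × Fin r,
      if p.1 < p.2 ∧ -w (eV r p.1 + eV r p.2) ∈ PhiPlus r then
        k ^ ((chiE (ip r (eV r p.1 + eV r p.2) c) : ℤ) - (chiO (ip r (eV r p.1 + eV r p.2) c) : ℤ))
      else 1) *
  ∏ a : Fin r,
      if -w ((2 : ℝ) • eV r a) ∈ PhiPlus r then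
        kr ^ (chiE (ip r ((2 : ℝ) • eV r a) c) : ℤ) * ur ^ (-(chiO (ip r ((2 : ℝ) • eV r a) c) : ℤ))
      else 1

/-- Iterated application `T_{i₁}(T_{i₂}(⋯(T_{i_ℓ}(f))⋯))`. -/
def applyT (k kr ur : F) (l : List ℕ) (f : QA F r) : QA F r :=
  l.foldr (fun i g => Top F r k kr ur i g) f

/-- The length function of the finite Weyl group `W₀`. -/
def w0len (g : E r → E r) : ℕ :=
  sInf {n | ∃ l : List ℕ, (∀ a ∈ l, 1 ≤ a ∧ a ≤ r) ∧ l.length = n ∧ (fun y => wordAct r l y) = g}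

/-- Membership in `W₀` (as maps on `ℝ^r`). -/
def IsW0fun (w : E r → E r) : Prop :=
  ∃ l : List ℕ, (∀ a ∈ l, 1 ≤ a ∧ a ≤ r) ∧ w = fun y => wordAct r l y

/-- Membership in the parabolic subgroup `W_{0,𝒪}` generated by the `s_i`, `1 ≤ i ≤ r`,
with `α_i(c^𝒪) = 0`. -/
def IsWOOfun (O : Set (E r)) (u : E r → E r) : Prop :=
  ∃ l : List ℕ, (∀ a ∈ l, 1 ≤ a ∧ a ≤ r ∧ alphaF r a (cpt r O) = 0) ∧
    u = fun y => wordAct r l y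

/-- `v ∈ W₀^𝒪`: `v ∈ W₀` of minimal length in its coset `v·W_{0,𝒪}`. -/
def MinRep (O : Set (E r)) (v : E r → E r) : Prop :=
  IsW0fun r v ∧ ∀ u, IsWOOfun r O u → w0len r v ≤ w0len r fun y => v (u y)

/-- Membership in the affine Weyl group `W` (as maps on `ℝ^r`). -/
def IsWfun (g : E r → E r) : Prop :=
  ∃ l : List ℕ, (∀ a ∈ l, a ≤ r) ∧ g = fun y => wordAct r l y

/-- Membership in the parabolic subgroup `W_{J(𝒪)}` generated by the `s_j`, `j ∈ J(𝒪)`. -/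
def IsWJfun (O : Set (E r)) (u : E r → E r) : Prop :=
  ∃ l : List ℕ, (∀ a ∈ l, a ≤ r ∧ alphaF r a (cpt r O) = 0) ∧ u = fun y => wordAct r l y

/-- The `W`-action on the Laurent polynomials `F[ℤ^r]` by `q`-dilations and reflections:
`w(x^μ) = x^{wμ}` for `w ∈ W₀`, `τ(λ)(x^μ) = q^{-⟨μ,λ⟩} x^μ` (globally defined via the
linear/translation parts of `g`). -/
def LWact (qh : Fˣ) (g : E r → E r) : Module.End F (QA F r) :=
  mkOp F r fun v => (((qh * qh) ^ (-⌊ip r (g v - g 0) (g 0)⌋) : Fˣ) : F) • X F r (g v - g 0)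

/-! ### roots `ᾱ_j`, torus reflections -/

/-- The finite simple roots `ᾱ₀ = -2ε₁`, `ᾱ_i = ε_i - ε_{i+1}`, `ᾱ_r = 2ε_r`
(as integral vectors). -/
def abarI (j : ℕ) : Fin r → ℤ := fun m =>
  if j = 0 then (if (m : ℕ) = 0 then -2 else 0)
  else if j = r then (if (m : ℕ) + 1 = r then 2 else 0)
  else if (m : ℕ) + 1 = j then 1
  else if (m : ℕ) = j then -1
  else 0

/-- The corresponding coroots `ᾱ₀^∨ = -ε₁`, `ᾱ_i^∨ = ε_i - ε_{i+1}`, `ᾱ_r^∨ = ε_r`. -/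
def abarV (j : ℕ) : Fin r → ℤ := fun m =>
  if j = 0 then (if (m : ℕ) = 0 then -1 else 0)
  else if j = r then (if (m : ℕ) + 1 = r then 1 else 0)
  else if (m : ℕ) + 1 = j then 1
  else if (m : ℕ) = j then -1
  else 0

/-- `ᾱ_j` as a real vector. -/
def abarR (j : ℕ) : E r := fun m => ((abarI r j m : ℤ) : ℝ)

/-- The constants `c₀ = u₀u_r`, `c_i = k²`, `c_r = k₀k_r`. -/
def cpar (k0 u0 k kr ur : Fˣ) (j : ℕ) : Fˣ :=
  if j = 0 then u0 * ur else if j = r then k0 * kr else k * k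

/-- The action of the reflection `s_{ᾱ_j} ∈ W₀` on the torus `T` (with `s_{ᾱ₀} = s_{ε₁}`). -/
def sTor (j : ℕ) (t : Fin r → Fˣ) : Fin r → Fˣ := fun m =>
  if j = 0 then (if (m : ℕ) = 0 then (t m)⁻¹ else t m)
  else if j = r then (if (m : ℕ) + 1 = r then (t m)⁻¹ else t m)
  else if (m : ℕ) + 1 = j then tcU F r t (j + 1)
  else if (m : ℕ) = j then tcU F r t j
  else t m

/-! ### The operators `G_t^𝒪(a)` for affine roots `a = (α, n)` -/

/-- The coroot `α^∨ = 2α/⟨α,α⟩`. -/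
def coroot (v : E r) : E r := ((2 : ℝ) / ip r v v) • v

/-- The scalar `q^{2n/⟨α,α⟩}` appearing in `x^{a^∨}` for `a = (α,n)`. -/
def qsc (qh : Fˣ) (v : E r) (n : ℤ) : Fˣ := if ip r v v = 4 then qh ^ n else (qh * qh) ^ n

/-- `𝐤_a`: `k` if `α` is short; `k_r` if `α` long, `n` even; `k₀` if `α` long, `n` odd. -/
def kaf (k0 k kr : Fˣ) (v : E r) (n : ℤ) : Fˣ :=
  if ip r v v = 4 then (if Even n then kr else k0) else k

/-- `𝐤_{a/2}`: `k` if `α` is short; `u_r` if `α` long, `n` even; `u₀` if `α` long, `n` odd. -/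
def khaf (u0 k ur : Fˣ) (v : E r) (n : ℤ) : Fˣ :=
  if ip r v v = 4 then (if Even n then ur else u0) else k

/-- The reflection `s_α(y) = y - α(y)·α^∨`. -/
def sRefl (v y : E r) : E r := y - ip r v y • coroot r v

/-- `s_{a,t}(x^y) = (g_y t)^{-n α^∨} · x^{s_α y}`. -/
def saTel (qh : Fˣ) (t : Fin r → Fˣ) (v : E r) (n : ℤ) (y : E r) : QA F r :=
  ((upowR F r (torusAct F r qh (gfun r y) t) (((-n : ℤ) : ℝ) • coroot r v) : Fˣ) : F) •
    X F r (sRefl r v y)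

/-- The twisted reflection operator `s_{a,t}`. -/
def SaOp (qh : Fˣ) (t : Fin r → Fˣ) (v : E r) (n : ℤ) : Module.End F (QA F r) :=
  mkOp F r (saTel F r qh t v n)

/-- The value `G_t^𝒪(a)(x^y)` for the affine root `a = (v, n)`. -/
def Gel (qh k0 u0 k kr ur : Fˣ) (t : Fin r → Fˣ) (v : E r) (n : ℤ) (y : E r) : QA F r :=
  (((kaf F r k0 k kr v n : Fˣ) : F) ^ chiE (ip r v y) *
      ((khaf F r u0 k ur v n : Fˣ) : F) ^ chiO (ip r v y)) • X F r y
    + ((((kaf F r k0 k kr v n : Fˣ) : F) - ((kaf F r k0 k kr v n : Fˣ) : F)⁻¹) •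
          geomS F r (((qsc F r qh v n)⁻¹ * (qsc F r qh v n)⁻¹ : Fˣ) : F)
            ((-2 : ℝ) • coroot r v) (-floorE (ip r v y) / 2)
        + (((khaf F r u0 k ur v n : Fˣ) : F) - ((khaf F r u0 k ur v n : Fˣ) : F)⁻¹) •
          ((((qsc F r qh v n)⁻¹ : Fˣ) : F) • X F r ((-1 : ℝ) • coroot r v) *
            geomS F r (((qsc F r qh v n)⁻¹ * (qsc F r qh v n)⁻¹ : Fˣ) : F)
              ((-2 : ℝ) • coroot r v) (-(floorO (ip r v y) + 1) / 2))) *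
      saTel F r qh t v n y

/-- The operator `G_t^𝒪(a)` for `a = (v, n)`. -/
def Gop (qh k0 u0 k kr ur : Fˣ) (t : Fin r → Fˣ) (v : E r) (n : ℤ) : Module.End F (QA F r) :=
  mkOp F r (Gel F r qh k0 u0 k kr ur t v n)

/-- The twisted action `g_t` of `g ∈ W` on `F[𝒪]`:
`g_t(x^y) = (g_{w₀ y} t)^{-λ} x^{w₀ y}` for `g = τ(λ) w₀`. -/
def Wtw (qh : Fˣ) (t : Fin r → Fˣ) (g : E r → E r) : Module.End F (QA F r) :=
  mkOp F r fun y =>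
    (((upowR F r (torusAct F r qh (gfun r (g y - g 0)) t) (g 0))⁻¹ : Fˣ) : F) •
      X F r (g y - g 0)

/-! ### The operators `D_j` -/

/-- The palindromic word `1, …, r-1, r, r-1, …, 1`. -/
def palin : List ℕ :=
  ((List.range (r - 1)).map (· + 1)) ++ [r] ++ ((List.range (r - 1)).map (· + 1)).reverse

/-- Multiplication by `x^{-ε₁}`. -/
def Mop : Module.End F (QA F r) := mkOp F r fun y => X F r ((-1 : ℝ) • epsV r 1) * X F r y

/-- `D₀ = (T₁^𝒪 ⋯ T_{r-1}^𝒪 T_r^𝒪 T_{r-1}^𝒪 ⋯ T₁^𝒪)⁻¹ ∘ M`. -/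
def D0op (qh : Fˣ) (k0 u0 k kr ur : F) (t : Fin r → Fˣ) : Module.End F (QA F r) :=
  ((palin r).map (TfullInv F r qh k0 u0 k kr ur t)).prod * Mop F r

/-- `D_j`: `D₀` for `j = 0` and `T_j^𝒪` for `1 ≤ j ≤ r`. -/
def Dop (qh : Fˣ) (k0 u0 k kr ur : F) (t : Fin r → Fˣ) (j : ℕ) : Module.End F (QA F r) :=
  if j = 0 then D0op F r qh k0 u0 k kr ur t else Tfull F r qh k0 u0 k kr ur t j

/-- Iterated application `D_{j₁}(D_{j₂}(⋯(D_{j_ℓ}(f))⋯))`. -/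
def applyD (qh : Fˣ) (k0 u0 k kr ur : F) (t : Fin r → Fˣ) (l : List ℕ) (f : QA F r) : QA F r :=
  l.foldr (fun j g => Dop F r qh k0 u0 k kr ur t j g) f

/-- The coefficients `k_{s_j}(y)`. -/
def ksj (k kr ur : Fˣ) (j : ℕ) (y : E r) : Fˣ :=
  if j = 0 then
    kr ^ (-etaE (2 * cd r y 1)) * ur ^ (-etaO (2 * cd r y 1)) *
      ∏ m : Fin r,
        (if 1 ≤ (m : ℕ) then k ^ (-eta (cd r y 1 - y m) - eta (cd r y 1 + y m)) else 1)
  else if j = r then kr ^ (-etaE (2 * cd r y r)) * ur ^ (-etaO (2 * cd r y r))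
  else k ^ (-eta (cd r y j - cd r y (j + 1)))

/-- `k_w(c) = ∏_m k_{s_{j_m}}(s_{j_{m+1}} ⋯ s_{j_ℓ} c)` for the word `w = s_{j₁} ⋯ s_{j_ℓ}`. -/
def kword (k kr ur : Fˣ) (l : List ℕ) (z : E r) : Fˣ :=
  (l.foldr (fun j p => (genF r j p.1, ksj F r k kr ur j p.1 * p.2)) (z, (1 : Fˣ))).2


/-! ### Part 1: coordinates, reflections and signed permutations -/

theorem cd_fin {r : ℕ} (y : E r) (m : Fin r) : cd r y ((m : ℕ) + 1) = y m := by
  unfold cd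
  have : ∀ n : Fin r, (if (n : ℕ) + 1 = (m : ℕ) + 1 then y n else 0) = if n = m then y n else 0 := by
    intro n
    by_cases h : n = m
    · simp [h]
    · have : (n : ℕ) ≠ m := fun h' => h (Fin.ext h')
      simp [h, this]
  rw [Finset.sum_congr rfl fun n _ => this n]
  simp

theorem cd_eq {r : ℕ} (y : E r) (i : ℕ) (h : i - 1 < r) (hi : 1 ≤ i) : cd r y i = y ⟨i - 1, h⟩ := by
  have := cd_fin y ⟨i - 1, h⟩
  rw [← this]; congr 1; simp; omega

theorem ip_eV {r : ℕ} (a : Fin r) (y : E r) : ip r (eV r a) y = y a := by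
  simp [ip, eV]

theorem ip_add_left {r : ℕ} (u v y : E r) : ip r (u + v) y = ip r u y + ip r v y := by
  simp [ip, add_mul, Finset.sum_add_distrib]

theorem ip_smul_left {r : ℕ} (c : ℝ) (v y : E r) : ip r (c • v) y = c * ip r v y := by
  simp [ip, Finset.mul_sum, mul_assoc]

theorem ip_neg_left {r : ℕ} (v y : E r) : ip r (-v) y = - ip r v y := by
  simp [ip]

theorem ip_sub_left {r : ℕ} (u v y : E r) : ip r (u - v) y = ip r u y - ip r v y := by
  simp [ip, sub_mul, Finset.sum_sub_distrib]

theorem ip_comm' {r : ℕ} (u v : E r) : ip r u v = ip r v u := by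
  simp [ip, mul_comm]

theorem ip_add_right {r : ℕ} (u v y : E r) : ip r y (u + v) = ip r y u + ip r y v := by
  rw [ip_comm', ip_add_left, ip_comm' u, ip_comm' v]

theorem ip_sub_right {r : ℕ} (u v y : E r) : ip r y (u - v) = ip r y u - ip r y v := by
  rw [ip_comm', ip_sub_left, ip_comm' u, ip_comm' v]

theorem ip_smul_right {r : ℕ} (c : ℝ) (v y : E r) : ip r y (c • v) = c * ip r y v := by
  rw [ip_comm', ip_smul_left, ip_comm' v]

/-- real version of the coroot vector `abarV` -/
def abV (r : ℕ) (j : ℕ) : E r := fun m => ((abarV r j m : ℤ) : ℝ)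

theorem abarR_zero {r : ℕ} (h : 0 < r) : abarR r 0 = (-2 : ℝ) • eV r ⟨0, h⟩ := by
  funext m
  simp only [abarR, abarI, eV, Pi.smul_apply, smul_eq_mul, Fin.ext_iff]
  split_ifs <;> simp_all

theorem abarR_last {r : ℕ} (h : r - 1 < r) : abarR r r = (2 : ℝ) • eV r ⟨r - 1, h⟩ := by
  funext m
  have : r ≠ 0 := by omega
  simp only [abarR, abarI, eV, Pi.smul_apply, smul_eq_mul, Fin.ext_iff]
  split_ifs <;> first | omega | simp_all

theorem abarR_mid {r : ℕ} (a b : Fin r) (h : (b : ℕ) = a + 1) :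
    abarR r (a + 1) = eV r a - eV r b := by
  funext m
  have := b.2
  simp only [abarR, abarI, eV, Pi.sub_apply, Fin.ext_iff]
  split_ifs <;> first | omega | simp_all

theorem abV_zero {r : ℕ} (h : 0 < r) : abV r 0 = (-1 : ℝ) • eV r ⟨0, h⟩ := by
  funext m
  simp only [abV, abarV, eV, Pi.smul_apply, smul_eq_mul, Fin.ext_iff]
  split_ifs <;> simp_all

theorem abV_last {r : ℕ} (h : r - 1 < r) : abV r r = eV r ⟨r - 1, h⟩ := by
  funext m
  have : r ≠ 0 := by omega
  simp only [abV, abarV, eV, Fin.ext_iff]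
  split_ifs <;> first | omega | simp_all

theorem abV_mid {r : ℕ} (a b : Fin r) (h : (b : ℕ) = a + 1) :
    abV r (a + 1) = eV r a - eV r b := by
  funext m
  have := b.2
  simp only [abV, abarV, eV, Pi.sub_apply, Fin.ext_iff]
  split_ifs <;> first | omega | simp_all

theorem j_cases {r : ℕ} {j : ℕ} (hj : j ≤ r) :
    j = 0 ∨ j = r ∨ ∃ a b : Fin r, (b : ℕ) = a + 1 ∧ j = a + 1 := by
  by_cases h0 : j = 0
  · exact Or.inl h0
  by_cases hr : j = r
  · exact Or.inr (Or.inl hr)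
  · refine Or.inr (Or.inr ⟨⟨j - 1, by omega⟩, ⟨j, by omega⟩, ?_, ?_⟩) <;> simp <;> omega

/-- the linear part of the `j`-th generator -/
def sbar (r : ℕ) (j : ℕ) (y : E r) : E r := y - ip r (abarR r j) y • abV r j

/-- the constant term of the `j`-th simple affine root -/
def nz (j : ℕ) : ℤ := if j = 0 then 1 else 0

theorem sEps1_eq {r : ℕ} (hr : 2 ≤ r) (y : E r) : sEps1 r y = sbar r 0 y := by
  funext m
  have h : 0 < r := by omega
  simp only [sEps1, sbar, abarR_zero h, abV_zero h, ip_smul_left, ip_eV, eV, Pi.sub_apply,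
    Pi.smul_apply, smul_eq_mul, Fin.ext_iff]
  split_ifs with h1
  · have : m = ⟨0, h⟩ := Fin.ext h1
    subst this; ring
  · simp

theorem sW_eq {r : ℕ} (hr : 2 ≤ r) {j : ℕ} (h1 : 1 ≤ j) (hj : j ≤ r) (y : E r) :
    sW r j y = sbar r j y := by
  rcases j_cases hj with h | h | ⟨a, b, hab, h⟩
  · omega
  · subst h
    have h : j - 1 < j := by omega
    funext m
    simp only [sW, sbar, abarR_last h, abV_last h, ip_smul_left, ip_eV, eV, Pi.sub_apply,
      Pi.smul_apply, smul_eq_mul, Fin.ext_iff, if_true]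
    split_ifs with h1 h2 h2
    · have : m = ⟨j - 1, h⟩ := Fin.ext h2
      subst this; ring
    · omega
    · omega
    · simp
  · subst h
    have hb := b.2
    have hne : (a : ℕ) + 1 ≠ r := by omega
    have e1 : cd r y ((a : ℕ) + 1 + 1) = y b := by rw [← hab]; exact cd_fin y b
    have e2 : cd r y ((a : ℕ) + 1) = y a := cd_fin y a
    funext m
    simp only [sW, sbar, abarR_mid a b hab, abV_mid a b hab, ip_sub_left, ip_eV, eV, Pi.sub_apply,
      Pi.smul_apply, smul_eq_mul, Fin.ext_iff, if_neg hne, e1, e2]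
    by_cases h1 : m = a
    · subst h1; simp [hab]
    · have h1' : (m : ℕ) ≠ a := fun h => h1 (Fin.ext h)
      by_cases h2 : m = b
      · subst h2; simp [hab]
      · have h2' : (m : ℕ) ≠ b := fun h => h2 (Fin.ext h)
        have h3 : (m : ℕ) ≠ a + 1 := by omega
        simp [h1', h2', h3]

/-- an affine functional -/
def aff {r : ℕ} (v : E r) (n : ℤ) (y : E r) : ℝ := ip r v y + n

/-- affine reflection -/
def srt {r : ℕ} (v : E r) (n : ℤ) (y : E r) : E r := y - aff v n y • ((2 / ip r v v) • v)

theorem coroot_abar {r : ℕ} (hr : 2 ≤ r) {j : ℕ} (hj : j ≤ r) :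
    (2 / ip r (abarR r j) (abarR r j)) • abarR r j = abV r j := by
  rcases j_cases hj with h | h | ⟨a, b, hab, h⟩
  · subst h
    have h : 0 < r := by omega
    rw [abarR_zero h, abV_zero h, ip_smul_left, ip_eV, smul_smul]
    congr 1; simp [eV]
  · subst h
    have h : j - 1 < j := by omega
    rw [abarR_last h, abV_last h, ip_smul_left, ip_eV, smul_smul]
    simp [eV]
  · subst h
    have hne : a ≠ b := by intro h; rw [h] at hab; omega
    rw [abarR_mid a b hab, abV_mid a b hab, ip_sub_left, ip_eV, ip_eV]
    simp [eV, hne, hne.symm]; norm_num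

theorem genF_eq {r : ℕ} (hr : 2 ≤ r) {j : ℕ} (hj : j ≤ r) (y : E r) :
    genF r j y = srt (abarR r j) (nz j) y := by
  rw [srt, coroot_abar hr hj]
  by_cases h0 : j = 0
  · subst h0
    have h : 0 < r := by omega
    funext m
    simp only [genF, aff, nz, if_true, abarR_zero h, abV_zero h, ip_smul_left, ip_eV, eV,
      Pi.sub_apply, Pi.smul_apply, smul_eq_mul, Fin.ext_iff]
    split_ifs with h1
    · have : m = ⟨0, h⟩ := Fin.ext h1
      subst this; push_cast; ring
    · simp
  · simp only [genF, h0, if_false, sW_eq hr (by omega : 1 ≤ j) hj, sbar, aff, nz]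
    simp

theorem genF_eq_sbar {r : ℕ} (hr : 2 ≤ r) {j : ℕ} (hj : j ≤ r) (y : E r) :
    genF r j y = sbar r j y - (nz j : ℝ) • abV r j := by
  rw [genF_eq hr hj, srt, coroot_abar hr hj, sbar, aff, add_smul]; abel

/-- signed permutations -/
def SP {r : ℕ} (w : E r → E r) : Prop :=
  ∃ (π : Equiv.Perm (Fin r)) (σ : Fin r → ℤ), (∀ m, σ m = 1 ∨ σ m = -1) ∧
    ∀ y m, w y m = σ m * y (π m)

theorem SP.id {r : ℕ} : SP (fun y : E r => y) := ⟨1, fun _ => 1, by simp, by simp⟩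

theorem SP.comp {r : ℕ} {w w' : E r → E r} (h : SP w) (h' : SP w') : SP (fun y => w (w' y)) := by
  obtain ⟨π, σ, hσ, h⟩ := h
  obtain ⟨π', σ', hσ', h'⟩ := h'
  refine ⟨π.trans π', fun m => σ m * σ' (π m), fun m => ?_, fun y m => ?_⟩
  · rcases hσ m with e | e <;> rcases hσ' (π m) with e' | e' <;> simp [e, e']
  · show w (w' y) m = _
    rw [h, h']; push_cast; simp [mul_assoc]

theorem SP.sbar {r : ℕ} (hr : 2 ≤ r) {j : ℕ} (hj : j ≤ r) : SP (sbar r j) := by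
  rcases j_cases hj with h | h | ⟨a, b, hab, h⟩
  · subst h
    refine ⟨1, fun m => if (m : ℕ) = 0 then -1 else 1, fun m => ?_, fun y m => ?_⟩
    · dsimp only; split_ifs <;> simp
    · rw [← sEps1_eq hr, sEps1]; dsimp only; split_ifs <;> simp
  · subst h
    refine ⟨1, fun m => if (m : ℕ) + 1 = j then -1 else 1, fun m => ?_, fun y m => ?_⟩
    · dsimp only; split_ifs <;> simp
    · rw [← sW_eq hr (by omega) le_rfl, sW]; simp only [if_true]; split_ifs <;> simp
  · subst h
    have hne : a ≠ b := by intro h; rw [h] at hab; omega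
    refine ⟨Equiv.swap a b, fun m => 1, by simp, fun y m => ?_⟩
    simp only [QP.sbar, abarR_mid a b hab, abV_mid a b hab, ip_sub_left, ip_eV, eV, Pi.sub_apply,
      Pi.smul_apply, smul_eq_mul]
    by_cases h1 : m = a
    · subst h1; simp [hne]
    · by_cases h2 : m = b
      · subst h2; simp [h1]
      · simp [h1, h2, Equiv.swap_apply_of_ne_of_ne]

theorem SP.add {r : ℕ} {w : E r → E r} (h : SP w) (x y : E r) : w (x + y) = w x + w y := by
  obtain ⟨π, σ, hσ, h⟩ := h
  funext m; simp [h, mul_add]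

theorem SP.sub {r : ℕ} {w : E r → E r} (h : SP w) (x y : E r) : w (x - y) = w x - w y := by
  obtain ⟨π, σ, hσ, h⟩ := h
  funext m; simp [h, mul_sub]

theorem SP.smul {r : ℕ} {w : E r → E r} (h : SP w) (c : ℝ) (y : E r) : w (c • y) = c • w y := by
  obtain ⟨π, σ, hσ, h⟩ := h
  funext m; simp [h]; ring

theorem SP.ip {r : ℕ} {w : E r → E r} (h : SP w) (x y : E r) : ip r (w x) (w y) = ip r x y := by
  obtain ⟨π, σ, hσ, h⟩ := h
  unfold QP.ip
  rw [← Equiv.sum_comp π (fun m => x m * y m)]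
  refine Finset.sum_congr rfl fun m _ => ?_
  rw [h, h]
  rcases hσ m with e | e <;> simp [e]

/-- The roots of type `C_r`. -/
def IsRt {r : ℕ} (v : E r) : Prop :=
  ∃ (a b : Fin r) (σ τ : ℤ), (σ = 1 ∨ σ = -1) ∧ (τ = 1 ∨ τ = -1) ∧ (a ≠ b ∨ σ = τ) ∧
    v = (σ : ℝ) • eV r a + (τ : ℝ) • eV r b

theorem SP.eV {r : ℕ} {w : E r → E r} (h : SP w) : ∃ (π : Equiv.Perm (Fin r)) (σ : Fin r → ℤ),
    (∀ m, σ m = 1 ∨ σ m = -1) ∧ ∀ a, w (eV r a) = (σ a : ℝ) • eV r (π a) := by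
  obtain ⟨π, σ, hσ, h⟩ := h
  refine ⟨π.symm, fun a => σ (π.symm a), fun m => hσ _, fun a => ?_⟩
  funext m
  simp only [h, QP.eV, Pi.smul_apply, smul_eq_mul]
  by_cases e : π m = a
  · subst e; simp
  · have : m ≠ π.symm a := by intro h; apply e; rw [h]; simp
    simp [e, this]

theorem SP.isRt {r : ℕ} {w : E r → E r} (h : SP w) {v : E r} (hv : IsRt v) : IsRt (w v) := by
  obtain ⟨π, s, hs, he⟩ := h.eV
  obtain ⟨a, b, σ, τ, hσ, hτ, hab, rfl⟩ := hv
  refine ⟨π a, π b, σ * s a, τ * s b, ?_, ?_, ?_, ?_⟩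
  · rcases hσ with e | e <;> rcases hs a with e' | e' <;> simp [e, e']
  · rcases hτ with e | e <;> rcases hs b with e' | e' <;> simp [e, e']
  · by_cases hh : a = b
    · subst hh; right
      rcases hab with h | h
      · exact absurd rfl h
      · rw [h]
    · left; exact fun h => hh (π.injective h)
  · rw [h.add, h.smul, h.smul, he, he, smul_smul, smul_smul]; push_cast; rfl

theorem IsRt.neg {r : ℕ} {v : E r} (hv : IsRt v) : IsRt (-v) := by
  obtain ⟨a, b, σ, τ, hσ, hτ, hab, rfl⟩ := hv
  refine ⟨a, b, -σ, -τ, by omega, by omega, by omega, ?_⟩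
  push_cast; rw [neg_smul, neg_smul]; abel

theorem IsRt.ip_pos {r : ℕ} {v : E r} (hv : IsRt v) : 0 < ip r v v := by
  obtain ⟨a, b, σ, τ, hσ, hτ, hab, rfl⟩ := hv
  rw [ip_add_left, ip_smul_left, ip_smul_left, ip_eV, ip_eV]
  simp only [eV, Pi.add_apply, Pi.smul_apply, smul_eq_mul]
  by_cases h : a = b
  · subst h
    rcases hab with h | h
    · exact absurd rfl h
    · subst h; rcases hσ with e | e <;> simp [e]
  · rcases hσ with e | e <;> rcases hτ with e' | e' <;> simp [e, e', h, Ne.symm h]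

theorem isRt_abar {r : ℕ} (hr : 2 ≤ r) {j : ℕ} (hj : j ≤ r) : IsRt (abarR r j) := by
  rcases j_cases hj with h | h | ⟨a, b, hab, h⟩
  · subst h
    have h : 0 < r := by omega
    refine ⟨⟨0, h⟩, ⟨0, h⟩, -1, -1, by simp, by simp, by simp, ?_⟩
    rw [abarR_zero h, ← add_smul]; norm_num
  · subst h
    have h : j - 1 < j := by omega
    refine ⟨⟨j - 1, h⟩, ⟨j - 1, h⟩, 1, 1, by simp, by simp, by simp, ?_⟩
    rw [abarR_last h, ← add_smul]; norm_num
  · subst h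
    have hne : a ≠ b := by intro h; rw [h] at hab; omega
    refine ⟨a, b, 1, -1, by simp, by simp, Or.inl hne, ?_⟩
    rw [abarR_mid a b hab]; simp [sub_eq_add_neg]

theorem ip_abar_abV {r : ℕ} (hr : 2 ≤ r) {j : ℕ} (hj : j ≤ r) :
    ip r (abarR r j) (abV r j) = 2 := by
  rw [← coroot_abar hr hj, ip_smul_right]
  have := (isRt_abar hr hj).ip_pos
  field_simp

theorem sbar_sbar {r : ℕ} (hr : 2 ≤ r) {j : ℕ} (hj : j ≤ r) (y : E r) :
    sbar r j (sbar r j y) = y := by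
  conv_lhs => rw [sbar]
  rw [sbar, ip_sub_right, ip_smul_right, ip_abar_abV hr hj]
  funext m; simp; ring

theorem sbar_abV {r : ℕ} (hr : 2 ≤ r) {j : ℕ} (hj : j ≤ r) :
    sbar r j (abV r j) = - abV r j := by
  rw [sbar, ip_abar_abV hr hj]
  funext m; simp; ring

theorem genF_genF {r : ℕ} (hr : 2 ≤ r) {j : ℕ} (hj : j ≤ r) (y : E r) :
    genF r j (genF r j y) = y := by
  rw [genF_eq_sbar hr hj (genF r j y), genF_eq_sbar hr hj y, (SP.sbar hr hj).sub,
    (SP.sbar hr hj).smul, sbar_sbar hr hj, sbar_abV hr hj]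
  simp

/-! ### Part 2: the fundamental alcove and the exchange property -/

theorem aff_genF {r : ℕ} (hr : 2 ≤ r) {j : ℕ} (hj : j ≤ r) {v : E r} (hv : IsRt v) (n : ℤ) :
    ∃ (v' : E r) (n' : ℤ), IsRt v' ∧ (∀ y, aff v n (genF r j y) = aff v' n' y) ∧
      ∀ y, srt v' n' y = genF r j (srt v n (genF r j y)) := by
  have hs := SP.sbar hr hj
  have h_int : ∃ e : ℤ, (nz j : ℝ) * ip r v (abV r j) = e := by
    obtain ⟨a, b, σ, τ, hσ, hτ, hab, rfl⟩ := hv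
    refine ⟨nz j * (σ * abarV r j a + τ * abarV r j b), ?_⟩
    rw [ip_add_left, ip_smul_left, ip_smul_left, ip_eV, ip_eV]
    simp [abV]
  obtain ⟨e, he⟩ := h_int
  have h1 : ∀ y, aff v n (genF r j y) = aff (sbar r j v) (n - e) y := by
    intro y
    have : ip r v (sbar r j y) = ip r (sbar r j v) y := by
      rw [← hs.ip (sbar r j v) y, sbar_sbar hr hj]
    simp only [aff]
    rw [genF_eq_sbar hr hj, ip_sub_right, ip_smul_right, this, he]
    push_cast; ring
  refine ⟨sbar r j v, n - e, hs.isRt hv, h1, fun y => ?_⟩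
  have h2 : genF r j (srt v n (genF r j y)) = genF r j (genF r j y) -
      sbar r j (aff v n (genF r j y) • (2 / ip r v v) • v) := by
    rw [srt, genF_eq_sbar hr hj, hs.sub, genF_eq_sbar hr hj (genF r j y)]; abel
  rw [h2, genF_genF hr hj, h1, hs.smul, hs.smul, srt, hs.ip]

theorem aff_sign {r : ℕ} {v : E r} (hv : IsRt v) (n : ℤ) :
    (∀ c ∈ CplusCl r, 0 ≤ aff v n c) ∨ (∀ c ∈ CplusCl r, aff v n c ≤ 0) := by
  obtain ⟨a, b, σ, τ, hσ, hτ, hab, rfl⟩ := hv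
  simp only [aff, ip_add_left, ip_smul_left, ip_eV]
  have key : ∀ (x : ℤ), 0 ≤ x ∨ x ≤ -1 := by intro x; omega
  have cst : ∀ x : ℤ, (0 ≤ x → (0 : ℝ) ≤ x) ∧ (x ≤ -1 → (x : ℝ) ≤ -1) ∧ (1 ≤ x → (1 : ℝ) ≤ x)
      ∧ (x ≤ 0 → (x : ℝ) ≤ 0) := by
    intro x; refine ⟨fun h => by exact_mod_cast h, fun h => by exact_mod_cast h,
      fun h => by exact_mod_cast h, fun h => by exact_mod_cast h⟩
  obtain ⟨c1, c2, c3, c4⟩ := cst n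
  have bd : ∀ c ∈ CplusCl r, (0 ≤ c a ∧ c a ≤ 1 / 2) ∧ (0 ≤ c b ∧ c b ≤ 1 / 2) := fun c hc =>
    ⟨hc.2 a, hc.2 b⟩
  rcases hσ with rfl | rfl <;> rcases hτ with rfl | rfl
  · rcases key n with h | h
    · left; intro c hc; have := bd c hc; have := c1 h; push_cast; linarith
    · right; intro c hc; have := bd c hc; have := c2 h; push_cast; linarith
  · have hne : a ≠ b := by rcases hab with h | h; exact h; omega
    rcases lt_or_gt_of_ne hne with hlt | hlt
    · rcases key n with h | h
      · left; intro c hc; have := bd c hc; have := c1 h; have := hc.1 a b hlt.le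
        push_cast; linarith
      · right; intro c hc; have := bd c hc; have := c2 h; push_cast; linarith
    · rcases key (n - 1) with h | h
      · left; intro c hc; have := bd c hc; have := c3 (by omega); push_cast; linarith
      · right; intro c hc; have := bd c hc; have := c4 (by omega); have := hc.1 b a hlt.le
        push_cast; linarith
  · have hne : a ≠ b := by rcases hab with h | h; exact h; omega
    rcases lt_or_gt_of_ne hne with hlt | hlt
    · rcases key (n - 1) with h | h
      · left; intro c hc; have := bd c hc; have := c3 (by omega); push_cast; linarith
      · right; intro c hc; have := bd c hc; have := c4 (by omega); have := hc.1 a b hlt.le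
        push_cast; linarith
    · rcases key n with h | h
      · left; intro c hc; have := bd c hc; have := c1 h; have := hc.1 b a hlt.le
        push_cast; linarith
      · right; intro c hc; have := bd c hc; have := c2 h; push_cast; linarith
  · rcases key (n - 1) with h | h
    · left; intro c hc; have := bd c hc; have := c3 (by omega); push_cast; linarith
    · right; intro c hc; have := bd c hc; have := c4 (by omega); push_cast; linarith

/-- vertices of the alcove -/
def vx (r : ℕ) (i : ℕ) : E r := fun m => if (m : ℕ) < i then 1 / 2 else 0

theorem vx_mem {r : ℕ} (i : ℕ) : vx r i ∈ CplusCl r := by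
  refine ⟨fun a b hab => ?_, fun m => ?_⟩
  · have : (a : ℕ) ≤ b := hab
    unfold vx; split_ifs <;> first | omega | norm_num
  · unfold vx; split_ifs <;> norm_num

theorem alpha_vx {r : ℕ} (hr : 2 ≤ r) {j : ℕ} (hj : j ≤ r) :
    aff (abarR r j) (nz j) (vx r j) ≠ 0 ∧
      ∀ i ≤ r, i ≠ j → aff (abarR r j) (nz j) (vx r i) = 0 := by
  rcases j_cases hj with h | h | ⟨a, b, hab, h⟩
  · subst h
    have h : 0 < r := by omega
    simp only [aff, nz, abarR_zero h, ip_smul_left, ip_eV, vx]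
    refine ⟨by simp, fun i hi h => ?_⟩
    have : 0 < i := by omega
    simp [this]
  · subst h
    have h : j - 1 < j := by omega
    have h0 : j ≠ 0 := by omega
    simp only [aff, nz, abarR_last h, ip_smul_left, ip_eV, vx]
    refine ⟨by simp [h, h0], fun i hi h => ?_⟩
    have : ¬ (j - 1 < i) := by omega
    simp [this, h0]
  · subst h
    simp only [aff, nz, abarR_mid a b hab, ip_sub_left, ip_eV, vx]
    refine ⟨by simp [hab], fun i hi h => ?_⟩
    by_cases h1 : (a : ℕ) < i
    · have : (b : ℕ) < i := by omega
      simp [h1, this]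
    · have : ¬ (b : ℕ) < i := by omega
      simp [h1, this]

theorem genF_vx {r : ℕ} (hr : 2 ≤ r) {i j : ℕ} (hj : j ≤ r) (hi : i ≤ r) (h : i ≠ j) :
    genF r j (vx r i) = vx r i := by
  rw [genF_eq hr hj, srt, (alpha_vx hr hj).2 i hi h]; simp

theorem aff_vx {r : ℕ} (v : E r) (n : ℤ) :
    aff v n (vx r 0) = n ∧ ∀ m : Fin r, v m = 2 * (aff v n (vx r (m + 1)) - aff v n (vx r m)) := by
  constructor
  · simp [aff, vx, ip]
  · intro m
    have : vx r (m + 1) = vx r m + (1 / 2 : ℝ) • eV r m := by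
      funext a
      simp only [vx, eV, Pi.add_apply, Pi.smul_apply, smul_eq_mul, Fin.ext_iff]
      split_ifs <;> first | omega | norm_num
    simp only [aff, this]
    rw [ip_add_right, ip_smul_right, ip_comm' v (eV r m), ip_eV]; ring

theorem srt_simple {r : ℕ} (hr : 2 ≤ r) {j : ℕ} (hj : j ≤ r) {v : E r} (hv : IsRt v) (n : ℤ)
    (hp : ∀ c ∈ CplusCl r, 0 ≤ aff v n c) (hn : ∀ c ∈ CplusCl r, aff v n (genF r j c) ≤ 0)
    (y : E r) : srt v n y = genF r j y := by
  obtain ⟨ha, hb⟩ := alpha_vx hr hj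
  obtain ⟨lam, hlam⟩ : ∃ lam : ℝ, aff v n (vx r j) = lam * aff (abarR r j) (nz j) (vx r j) :=
    ⟨aff v n (vx r j) / aff (abarR r j) (nz j) (vx r j), by field_simp⟩
  have hall : ∀ i ≤ r, aff v n (vx r i) = lam * aff (abarR r j) (nz j) (vx r i) := by
    intro i hi
    by_cases h : i = j
    · subst h; exact hlam
    · rw [hb i hi h, mul_zero]
      refine le_antisymm ?_ (hp _ (vx_mem i))
      have := hn _ (vx_mem i)
      rwa [genF_vx hr hj hi h] at this
  have hvv : v = lam • abarR r j := by
    funext m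
    have h1 := (aff_vx v n).2 m
    have h2 := (aff_vx (abarR r j) (nz j)).2 m
    have := m.2
    rw [hall _ (by omega), hall _ (by omega)] at h1
    rw [Pi.smul_apply, smul_eq_mul, h1, h2]; ring
  have hnn : (n : ℝ) = lam * nz j := by
    rw [← (aff_vx v n).1, hall 0 (by omega), (aff_vx (abarR r j) (nz j)).1]
  have hl0 : lam ≠ 0 := by
    rintro rfl
    have := hv.ip_pos
    rw [hvv] at this; simp [ip] at this
  have h1 : aff v n y = lam * aff (abarR r j) (nz j) y := by
    simp only [aff]; rw [hnn]
    conv_lhs => rw [hvv]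
    rw [ip_smul_left]; ring
  have h2 := (isRt_abar hr hj).ip_pos
  rw [genF_eq hr hj, srt, srt, h1, hvv, ip_smul_left, ip_smul_right, smul_smul, smul_smul,
    smul_smul]
  congr 2
  field_simp

/-- Exchange property. -/
theorem exchange {r : ℕ} (hr : 2 ≤ r) {c : E r} (hc : c ∈ CplusCl r) :
    ∀ (l : List ℕ), (∀ a ∈ l, a ≤ r) → ∀ (v : E r) (n : ℤ), IsRt v →
      (∀ c ∈ CplusCl r, 0 ≤ aff v n c) → aff v n (wordAct r l c) < 0 →
      ∃ l' : List ℕ, l'.Sublist l ∧ l'.length + 1 = l.length ∧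
        ∀ y, wordAct r l' y = srt v n (wordAct r l y) := by
  intro l
  induction l with
  | nil =>
    intro _ v n _ hp hn
    exact absurd (hp c hc) (not_le.2 hn)
  | cons j l ih =>
    intro hl v n hv hp hn
    have hj : j ≤ r := hl j (by simp)
    have hl' : ∀ a ∈ l, a ≤ r := fun a ha => hl a (by simp [ha])
    obtain ⟨v', n', hv', h1, h2⟩ := aff_genF hr hj hv n
    have e : ∀ y, wordAct r (j :: l) y = genF r j (wordAct r l y) := fun y => rfl
    rcases aff_sign hv' n' with hs | hs
    · rw [e, h1] at hn
      obtain ⟨l', hsub, hlen, hw⟩ := ih hl' v' n' hv' hs hn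
      refine ⟨j :: l', hsub.cons_cons j, by simp [hlen], fun y => ?_⟩
      show genF r j (wordAct r l' y) = _
      rw [hw, h2, genF_genF hr hj]; rfl
    · have hs' : ∀ c ∈ CplusCl r, aff v n (genF r j c) ≤ 0 := fun c hc => by
        rw [h1]; exact hs c hc
      refine ⟨l, List.sublist_cons_self j l, by simp, fun y => ?_⟩
      rw [srt_simple hr hj hv n hp hs', e, genF_genF hr hj]

theorem alpha_nonneg {r : ℕ} (hr : 2 ≤ r) {j : ℕ} (hj : j ≤ r) :
    ∀ c ∈ CplusCl r, 0 ≤ aff (abarR r j) (nz j) c := by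
  intro c hc
  rcases j_cases hj with h | h | ⟨a, b, hab, h⟩
  · subst h
    have h : 0 < r := by omega
    simp only [aff, nz, abarR_zero h, ip_smul_left, ip_eV]
    have := hc.2 ⟨0, h⟩
    push_cast; simp; linarith
  · subst h
    have h : j - 1 < j := by omega
    have h0 : j ≠ 0 := by omega
    simp only [aff, nz, abarR_last h, ip_smul_left, ip_eV, h0, if_false]
    have := hc.2 ⟨j - 1, h⟩
    push_cast; linarith
  · subst h
    simp only [aff, nz, abarR_mid a b hab, ip_sub_left, ip_eV]
    have := hc.1 a b (by show (a : ℕ) ≤ b; omega)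
    simp; linarith

theorem mem_CplusCl {r : ℕ} (hr : 2 ≤ r) {c : E r}
    (h : ∀ j ≤ r, 0 ≤ aff (abarR r j) (nz j) c) : c ∈ CplusCl r := by
  have hmono : ∀ n : ℕ, ∀ a b : Fin r, (b : ℕ) = a + n → c b ≤ c a := by
    intro n
    induction n with
    | zero => intro a b hab; rw [Fin.ext (by simpa using hab) (a := b) (b := a)]
    | succ n ih =>
      intro a b hab
      have hb := b.2
      have h1 := ih a ⟨a + n, by omega⟩ rfl
      have h2 := h (a + n + 1) (by omega)
      have := abarR_mid (⟨a + n, by omega⟩ : Fin r) b (by simp; omega)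
      simp only at this
      rw [aff, this, ip_sub_left, ip_eV, ip_eV, nz, if_neg (by omega)] at h2
      push_cast at h2
      linarith
  have hm : ∀ i j : Fin r, i ≤ j → c j ≤ c i := fun i j hij =>
    hmono (j - i) i j (by have : (i : ℕ) ≤ j := hij; omega)
  refine ⟨hm, fun m => ⟨?_, ?_⟩⟩
  · have h0 : r ≠ 0 := by omega
    have h1 := h r le_rfl
    rw [aff, abarR_last (by omega), ip_smul_left, ip_eV, nz, if_neg h0] at h1
    have := hm m ⟨r - 1, by omega⟩ (by show (m : ℕ) ≤ r - 1; omega)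
    push_cast at h1; linarith
  · have h1 := h 0 (by omega)
    rw [aff, abarR_zero (by omega), ip_smul_left, ip_eV, nz, if_pos rfl] at h1
    have := hm ⟨0, by omega⟩ m (by show 0 ≤ (m : ℕ); omega)
    push_cast at h1; linarith

/-! Words -/

theorem wordAct_append {r : ℕ} (l l' : List ℕ) (y : E r) :
    wordAct r (l ++ l') y = wordAct r l (wordAct r l' y) := by
  simp [wordAct]

theorem wordAct_reverse {r : ℕ} (hr : 2 ≤ r) (l : List ℕ) (hl : ∀ a ∈ l, a ≤ r) (y : E r) :
    wordAct r l.reverse (wordAct r l y) = y := by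
  induction l with
  | nil => rfl
  | cons j l ih =>
    rw [List.reverse_cons, wordAct_append]
    have : wordAct r [j] (wordAct r (j :: l) y) = wordAct r l y :=
      genF_genF hr (hl j (by simp)) _
    rw [this]
    exact ih fun a ha => hl a (by simp [ha])

theorem wordAct_reverse' {r : ℕ} (hr : 2 ≤ r) (l : List ℕ) (hl : ∀ a ∈ l, a ≤ r) (y : E r) :
    wordAct r l (wordAct r l.reverse y) = y := by
  have := wordAct_reverse hr l.reverse (by simpa using hl) y
  simpa using this

/-- shortest words from `c` to `y` -/
def SWd {r : ℕ} (c : E r) (l : List ℕ) (y : E r) : Prop :=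
  (∀ a ∈ l, a ≤ r) ∧ wordAct r l c = y ∧
    ∀ l' : List ℕ, (∀ a ∈ l', a ≤ r) → wordAct r l' c = y → l.length ≤ l'.length

theorem SWd.tail {r : ℕ} (hr : 2 ≤ r) {c : E r} {j : ℕ} {l : List ℕ} {y : E r}
    (h : SWd c (j :: l) y) : SWd c l (genF r j y) := by
  obtain ⟨h1, h2, h3⟩ := h
  have hj : j ≤ r := h1 j (by simp)
  refine ⟨fun a ha => h1 a (by simp [ha]), ?_, fun l' hl' e => ?_⟩
  · rw [← h2]; exact (genF_genF hr hj _).symm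
  · have := h3 (j :: l') (by intro a ha; rcases List.mem_cons.1 ha with rfl | h; exact hj; exact hl' a h)
      (by show genF r j (wordAct r l' c) = y; rw [e, genF_genF hr hj])
    simpa using this

theorem SWd.head_neg {r : ℕ} (hr : 2 ≤ r) {c : E r} (hc : c ∈ CplusCl r) {j : ℕ} {l : List ℕ}
    {y : E r} (h : SWd c (j :: l) y) : aff (abarR r j) (nz j) y < 0 := by
  have ht := h.tail hr
  obtain ⟨h1, h2, h3⟩ := h
  have hj : j ≤ r := h1 j (by simp)
  by_contra hneg
  push Not at hneg
  have hz : aff (abarR r j) (nz j) (genF r j y) = - aff (abarR r j) (nz j) y := by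
    rw [genF_eq hr hj, srt, coroot_abar hr hj]
    conv_lhs => rw [aff]
    rw [ip_sub_right, ip_smul_right, ip_abar_abV hr hj]; simp only [aff]; ring
  rcases hneg.eq_or_lt with h0 | h0
  · have : genF r j y = y := by rw [genF_eq hr hj, srt, ← h0]; simp
    have := h3 l ht.1 (by rw [ht.2.1, this])
    simp at this
  · obtain ⟨l', hs, hlen, hw⟩ := exchange hr hc l ht.1 _ _ (isRt_abar hr hj) (alpha_nonneg hr hj)
      (by rw [ht.2.1, hz]; linarith)
    have := h3 l' (fun a ha => ht.1 a (hs.subset ha))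
      (by rw [hw, ht.2.1, ← genF_eq hr hj, genF_genF hr hj])
    simp at this; omega

theorem SWd.exists {r : ℕ} {c y : E r} (h : ∃ l : List ℕ, (∀ a ∈ l, a ≤ r) ∧ wordAct r l c = y) :
    ∃ l, SWd c l y := by
  have : ∃ n : ℕ, ∃ l : List ℕ, (∀ a ∈ l, a ≤ r) ∧ wordAct r l c = y ∧ l.length = n := by
    obtain ⟨l, h1, h2⟩ := h; exact ⟨_, l, h1, h2, rfl⟩
  obtain ⟨l, h1, h2, h3⟩ := Nat.find_spec this
  exact ⟨l, h1, h2, fun l' h1' h2' => by rw [h3]; exact Nat.find_min' this ⟨l', h1', h2', rfl⟩⟩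

/-- uniqueness of the alcove point -/
theorem alcove_unique {r : ℕ} (hr : 2 ≤ r) {c y : E r} (hc : c ∈ CplusCl r) (hy : y ∈ CplusCl r)
    (h : ∃ l : List ℕ, (∀ a ∈ l, a ≤ r) ∧ wordAct r l c = y) : y = c := by
  obtain ⟨l, hl⟩ := SWd.exists h
  cases l with
  | nil => exact hl.2.1.symm
  | cons j l =>
    have h1 := hl.head_neg hr hc
    have := alpha_nonneg hr (hl.1 j (by simp)) y hy
    linarith

/-- shortest words for `y` all give the same element -/
theorem SWd.unique {r : ℕ} (hr : 2 ≤ r) {c : E r} (hc : c ∈ CplusCl r) :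
    ∀ (l l' : List ℕ) (y : E r), SWd c l y → SWd c l' y → ∀ z, wordAct r l z = wordAct r l' z := by
  intro l
  induction l with
  | nil =>
    intro l' y h h' z
    have := h'.2.2 [] (by simp) h.2.1
    have : l' = [] := List.length_eq_zero_iff.1 (by simpa using this)
    rw [this]
  | cons j l ih =>
    intro l' y h h' z
    have hj : j ≤ r := h.1 j (by simp)
    have hneg := h.head_neg hr hc
    obtain ⟨l'', hs, hlen, hw⟩ := exchange hr hc l' h'.1 _ _ (isRt_abar hr hj)
      (alpha_nonneg hr hj) (by rw [h'.2.1]; exact hneg)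
    have ht := h.tail hr
    have e1 := h.2.2 l' h'.1 h'.2.1
    have e2 := h'.2.2 _ h.1 h.2.1
    have ht' : SWd c l'' (genF r j y) := by
      refine ⟨fun a ha => h'.1 a (hs.subset ha), by rw [hw, h'.2.1, ← genF_eq hr hj], ?_⟩
      intro m hm hmc
      have := ht.2.2 m hm hmc
      simp at e1 e2; omega
    have := ih l'' _ ht ht' z
    show genF r j (wordAct r l z) = _
    rw [this, hw, ← genF_eq hr hj, genF_genF hr hj]

/-- any word contains a shortest word for its endpoint -/
theorem SWd.sub {r : ℕ} (hr : 2 ≤ r) {c : E r} (hc : c ∈ CplusCl r) :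
    ∀ (l : List ℕ), (∀ a ∈ l, a ≤ r) → ∃ l', l'.Sublist l ∧ SWd c l' (wordAct r l c) := by
  intro l
  induction l with
  | nil => intro _; exact ⟨[], List.Sublist.refl _, by simp, rfl, by simp⟩
  | cons j l ih =>
    intro hl
    have hj : j ≤ r := hl j (by simp)
    obtain ⟨m, hms, hm⟩ := ih fun a ha => hl a (by simp [ha])
    by_cases hsh : SWd c (j :: m) (wordAct r (j :: l) c)
    · exact ⟨_, hms.cons_cons j, hsh⟩
    have ejm : wordAct r (j :: m) c = wordAct r (j :: l) c := by
      show genF r j (wordAct r m c) = genF r j (wordAct r l c); rw [hm.2.1]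
    have hjm : ∀ a ∈ j :: m, a ≤ r := by
      intro a ha; rcases List.mem_cons.1 ha with rfl | h; exact hj; exact hm.1 a h
    obtain ⟨p, hp⟩ := SWd.exists ⟨j :: m, hjm, ejm⟩
    have hpl : p.length ≤ m.length := by
      have h1 := hp.2.2 _ hjm ejm
      by_contra hcon
      apply hsh
      refine ⟨hjm, ejm, fun q hq hqc => ?_⟩
      have := hp.2.2 q hq hqc
      simp at h1 ⊢; omega
    -- the sign at `z`
    set z := wordAct r l c with hz
    have hez : wordAct r (j :: l) c = genF r j z := rfl
    rw [hez] at hp ⊢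
    rcases lt_trichotomy (aff (abarR r j) (nz j) z) 0 with h0 | h0 | h0
    · obtain ⟨q, hqs, hqlen, hqw⟩ := exchange hr hc m hm.1 _ _ (isRt_abar hr hj)
        (alpha_nonneg hr hj) (by rw [hm.2.1]; exact h0)
      refine ⟨q, (hqs.trans hms).cons j, fun a ha => hm.1 a (hqs.subset ha), ?_, ?_⟩
      · rw [hqw, hm.2.1, genF_eq hr hj]
      · intro q' hq' hqc'
        have := hm.2.2 (j :: q') (by
          intro a ha; rcases List.mem_cons.1 ha with rfl | h; exact hj; exact hq' a h)
          (by show genF r j (wordAct r q' c) = z; rw [hqc', genF_genF hr hj])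
        simp at this; omega
    · have : genF r j z = z := by rw [genF_eq hr hj, srt, h0]; simp
      rw [this]
      exact ⟨m, hms.cons j, hm⟩
    · exfalso
      have hzn : aff (abarR r j) (nz j) (genF r j z) = - aff (abarR r j) (nz j) z := by
        rw [genF_eq hr hj, srt, coroot_abar hr hj]
        conv_lhs => rw [aff]
        rw [ip_sub_right, ip_smul_right, ip_abar_abV hr hj]; simp only [aff]; ring
      obtain ⟨q, hqs, hqlen, hqw⟩ := exchange hr hc p hp.1 _ _ (isRt_abar hr hj)
        (alpha_nonneg hr hj) (by rw [hp.2.1, hzn]; linarith)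
      have := hm.2.2 q (fun a ha => hp.1 a (hqs.subset ha))
        (by rw [hqw, hp.2.1, ← genF_eq hr hj, genF_genF hr hj])
      omega

/-- strong form of the order relation -/
def Plt {r : ℕ} (c : E r) (y' y : E r) : Prop :=
  ∀ l, SWd c l y → ∃ l', l'.Sublist l ∧ SWd c l' y' ∧ l'.length < l.length

theorem Plt.trans {r : ℕ} {c x y z : E r} (h : Plt c x y) (h' : Plt c y z) : Plt c x z := by
  intro l hl
  obtain ⟨m, hm1, hm2, hm3⟩ := h' l hl
  obtain ⟨n, hn1, hn2, hn3⟩ := h m hm2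
  exact ⟨n, hn1.trans hm1, hn2, hn3.trans hm3⟩

theorem Plt.refl_lower {r : ℕ} (hr : 2 ≤ r) {c : E r} (hc : c ∈ CplusCl r) {y : E r} {v : E r}
    (hv : IsRt v) (n : ℤ) (hp : ∀ c ∈ CplusCl r, 0 ≤ aff v n c) (hy : aff v n y < 0) :
    Plt c (srt v n y) y := by
  intro l hl
  obtain ⟨m, hms, hmlen, hmw⟩ := exchange hr hc l hl.1 v n hv hp (by rw [hl.2.1]; exact hy)
  obtain ⟨p, hps, hp⟩ := SWd.sub hr hc m (fun a ha => hl.1 a (hms.subset ha))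
  rw [hmw, hl.2.1] at hp
  exact ⟨p, hps.trans hms, hp, by have := hps.length_le; omega⟩

/-! ### Part 3: existence of the alcove point, the elements `g_y`, the order -/

/-- every word acts on coordinates by an affine signed permutation -/
theorem wordAct_coord {r : ℕ} (hr : 2 ≤ r) (l : List ℕ) (hl : ∀ a ∈ l, a ≤ r) :
    ∀ m : Fin r, ∃ (j : Fin r) (ε n : ℤ), (ε = 1 ∨ ε = -1) ∧
      ∀ y, wordAct r l y m = ε * y j + n := by
  induction l with
  | nil => intro m; exact ⟨m, 1, 0, by simp, fun y => by simp [wordAct]⟩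
  | cons a l ih =>
    intro m
    have ha : a ≤ r := hl a (by simp)
    obtain ⟨π, σ, hσ, h⟩ := SP.sbar hr ha
    obtain ⟨j, ε, n, hε, hj⟩ := ih (fun b hb => hl b (by simp [hb])) (π m)
    refine ⟨j, σ m * ε, σ m * n - nz a * abarV r a m, ?_, fun y => ?_⟩
    · rcases hσ m with e | e <;> rcases hε with e' | e' <;> simp [e, e']
    · show genF r a (wordAct r l y) m = _
      rw [genF_eq_sbar hr ha]
      simp only [Pi.sub_apply, Pi.smul_apply, smul_eq_mul, abV, h, hj]
      push_cast; ring

/-- a generic point of the alcove -/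
def pgen (r : ℕ) : E r := fun m => ((r : ℝ) - m) / (2 * r + 2)

theorem alpha_pgen {r : ℕ} (hr : 2 ≤ r) {j : ℕ} (hj : j ≤ r) :
    0 < aff (abarR r j) (nz j) (pgen r) := by
  have hr0 : (0 : ℝ) < r := by exact_mod_cast (by omega : 0 < r)
  rcases j_cases hj with h | h | ⟨a, b, hab, h⟩
  · subst h
    have h : 0 < r := by omega
    simp only [aff, nz, abarR_zero h, ip_smul_left, ip_eV, pgen]
    have : (r : ℝ) / (2 * r + 2) < 1 / 2 := by
      rw [div_lt_div_iff₀ (by linarith) (by norm_num)]; linarith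
    norm_num at *; linarith
  · subst h
    have h : j - 1 < j := by omega
    have h0 : j ≠ 0 := by omega
    simp only [aff, nz, abarR_last h, ip_smul_left, ip_eV, h0, if_false, pgen]
    have : ((j - 1 : ℕ) : ℝ) = (j : ℝ) - 1 := by push_cast [Nat.cast_sub (by omega : 1 ≤ j)]; ring
    rw [this]; push_cast
    have : 0 < ((j : ℝ) - (j - 1)) / (2 * j + 2) := by apply div_pos <;> linarith
    linarith
  · subst h
    simp only [aff, nz, abarR_mid a b hab, ip_sub_left, ip_eV, pgen]
    have : (b : ℝ) = a + 1 := by exact_mod_cast hab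
    rw [this, ← sub_div]
    simp only [Nat.add_eq_zero_iff, one_ne_zero, and_false, if_false]
    push_cast
    have : 0 < ((r : ℝ) - a - (r - (a + 1))) / (2 * r + 2) := by apply div_pos <;> linarith
    linarith

theorem exists_alcove {r : ℕ} (hr : 2 ≤ r) (y : E r) :
    ∃ l : List ℕ, (∀ a ∈ l, a ≤ r) ∧ wordAct r l y ∈ CplusCl r := by
  set p := pgen r
  let d : E r → ℝ := fun z => ip r (z - p) (z - p)
  let S : Set (E r) := {z | z ∈ orbit r y ∧ d z ≤ d y}
  have hyS : y ∈ S := ⟨⟨[], by simp, rfl⟩, le_rfl⟩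
  -- finiteness
  have hd0 : 0 ≤ d y := Finset.sum_nonneg fun m _ => mul_self_nonneg _
  obtain ⟨N, hN⟩ : ∃ N : ℕ, (∀ j, |y j| + (∑ m, |p m|) + d y + 1 ≤ N) := by
    obtain ⟨N, hN⟩ := exists_nat_ge ((∑ j, |y j|) + (∑ m, |p m|) + d y + 1)
    refine ⟨N, fun j => ?_⟩
    have := Finset.single_le_sum (f := fun j => |y j|) (fun i _ => abs_nonneg (y i))
      (Finset.mem_univ j)
    linarith
  let A : Set ℝ := (fun q : Fin r × ℤ × ℤ => (q.2.1 : ℝ) * y q.1 + q.2.2) ''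
    (Set.univ ×ˢ ({1, -1} ×ˢ Set.Icc (-(N : ℤ)) N))
  have hA : A.Finite := by
    apply Set.Finite.image
    exact Set.finite_univ.prod ((Set.toFinite _).prod (Set.finite_Icc _ _))
  have hfin : S.Finite := by
    refine (Set.Finite.pi' (t := fun _ : Fin r => A) (fun _ => hA)).subset ?_
    rintro z ⟨⟨l, hl, rfl⟩, hz⟩ m
    obtain ⟨j, ε, n, hε, hj⟩ := wordAct_coord hr l hl m
    rw [hj]
    refine ⟨(j, ε, n), ⟨Set.mem_univ _, by simpa using hε, ?_⟩, rfl⟩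
    have h1 : (wordAct r l y m - p m) ^ 2 ≤ d y := by
      refine le_trans ?_ hz
      have := Finset.single_le_sum (f := fun m => (wordAct r l y - p) m * (wordAct r l y - p) m)
        (fun i _ => mul_self_nonneg _) (Finset.mem_univ m)
      simp only [Pi.sub_apply] at this
      rw [sq]; exact this
    have h2 : |wordAct r l y m - p m| ≤ d y + 1 := by
      apply abs_le_of_sq_le_sq _ (by linarith)
      nlinarith
    have h3 := Finset.single_le_sum (f := fun m => |p m|) (fun i _ => abs_nonneg (p i))
      (Finset.mem_univ m)
    have h4 := hN j
    rw [hj] at h2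
    have h5 : |(ε : ℝ) * y j| = |y j| := by rcases hε with rfl | rfl <;> simp
    have h6 : |(n : ℝ)| ≤ N := by
      have e : (n : ℝ) = (ε * y j + n - p m) + p m - ε * y j := by ring
      rw [e]
      calc _ ≤ |(ε * y j + n - p m) + p m| + |ε * y j| := abs_sub _ _
        _ ≤ |(ε * y j + n - p m)| + |p m| + |ε * y j| := by gcongr; exact abs_add_le _ _
        _ ≤ N := by linarith
    rw [abs_le] at h6
    exact ⟨by exact_mod_cast h6.1, by exact_mod_cast h6.2⟩
  obtain ⟨z, hzS, hz⟩ := Set.exists_min_image S d hfin ⟨y, hyS⟩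
  obtain ⟨⟨l, hl, rfl⟩, hdz⟩ := hzS
  refine ⟨l, hl, mem_CplusCl hr fun j hj => ?_⟩
  by_contra hneg
  push Not at hneg
  set z := wordAct r l y
  have hlt : d (genF r j z) < d z := by
    have e : genF r j z - p = (z - p) - aff (abarR r j) (nz j) z • abV r j := by
      rw [genF_eq hr hj, srt, coroot_abar hr hj]; abel
    have h1 := (isRt_abar hr hj).ip_pos
    have h2 := ip_abar_abV hr hj
    have h3 : abV r j = (2 / ip r (abarR r j) (abarR r j)) • abarR r j := (coroot_abar hr hj).symm
    have h4 : ip r (abV r j) (abV r j) = 2 * (2 / ip r (abarR r j) (abarR r j)) := by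
      conv_lhs => rw [h3, ip_smul_left, ← h3, h2]
      ring
    have h5 : ip r (abV r j) (z - p) = (2 / ip r (abarR r j) (abarR r j)) *
        (aff (abarR r j) (nz j) z - aff (abarR r j) (nz j) p) := by
      rw [h3, ip_smul_left, ip_sub_right]; simp only [aff]; ring
    have h6 : d (genF r j z) = d z + 2 * (2 / ip r (abarR r j) (abarR r j)) *
        (aff (abarR r j) (nz j) z * aff (abarR r j) (nz j) p) := by
      simp only [d]
      rw [e]
      generalize z - p = u at h5 ⊢
      rw [ip_sub_left, ip_sub_right, ip_sub_right, ip_smul_left, ip_smul_left, ip_smul_right,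
        ip_smul_right, ip_comm' u (abV r j), h5, h4]
      ring
    have h7 : aff (abarR r j) (nz j) z * aff (abarR r j) (nz j) p < 0 :=
      mul_neg_of_neg_of_pos hneg (alpha_pgen hr hj)
    have h8 : 0 < 2 * (2 / ip r (abarR r j) (abarR r j)) := by positivity
    rw [h6]; nlinarith [mul_neg_of_pos_of_neg h8 h7]
  have hmem : genF r j z ∈ S := by
    refine ⟨⟨j :: l, ?_, rfl⟩, hlt.le.trans hdz⟩
    intro a ha; rcases List.mem_cons.1 ha with rfl | h; exact hj; exact hl a h
  exact absurd (hz _ hmem) (not_le.2 hlt)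

theorem orbit_genF {r : ℕ} {O : Set (E r)} (hO : IsOrbit r O) {y : E r}
    (hy : y ∈ O) (l : List ℕ) (hl : ∀ a ∈ l, a ≤ r) : wordAct r l y ∈ O := by
  obtain ⟨y0, rfl⟩ := hO
  obtain ⟨l0, hl0, rfl⟩ := hy
  refine ⟨l ++ l0, ?_, by rw [wordAct_append]⟩
  intro a ha; rcases List.mem_append.1 ha with h | h; exact hl a h; exact hl0 a h

theorem orbit_conn {r : ℕ} (hr : 2 ≤ r) {O : Set (E r)} (hO : IsOrbit r O) {y z : E r}
    (hy : y ∈ O) (hz : z ∈ O) : ∃ l : List ℕ, (∀ a ∈ l, a ≤ r) ∧ wordAct r l y = z := by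
  obtain ⟨y0, rfl⟩ := hO
  obtain ⟨l0, hl0, rfl⟩ := hy
  obtain ⟨l1, hl1, rfl⟩ := hz
  refine ⟨l1 ++ l0.reverse, ?_, by rw [wordAct_append, wordAct_reverse hr l0 hl0]⟩
  intro a ha; rcases List.mem_append.1 ha with h | h; exact hl1 a h
  exact hl0 a (by simpa using h)

theorem cpt_spec {r : ℕ} (hr : 2 ≤ r) {O : Set (E r)} (hO : IsOrbit r O) :
    cpt r O ∈ O ∧ cpt r O ∈ CplusCl r := by
  have h : ∃ c, c ∈ O ∧ c ∈ CplusCl r := by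
    obtain ⟨y0, rfl⟩ := hO
    obtain ⟨l, hl, hc⟩ := exists_alcove hr y0
    exact ⟨_, ⟨l, hl, rfl⟩, hc⟩
  rw [cpt, dif_pos h]
  exact h.choose_spec

theorem gW_spec {r : ℕ} (hr : 2 ≤ r) {O : Set (E r)} (hO : IsOrbit r O) {y : E r} (hy : y ∈ O) :
    SWd (cpt r O) (gW r y) y := by
  obtain ⟨hcO, hc⟩ := cpt_spec hr hO
  have back : ∀ l : List ℕ, (∀ a ∈ l, a ≤ r) → wordAct r l.reverse y ∈ CplusCl r →
      wordAct r l (cpt r O) = y := by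
    intro l hl h
    have h1 : wordAct r l.reverse y ∈ O := orbit_genF hO hy _ (by simpa using hl)
    have := alcove_unique hr hc h (orbit_conn hr hO hcO h1)
    rw [← this, wordAct_reverse' hr l hl]
  obtain ⟨l, hl⟩ := SWd.exists (orbit_conn hr hO hcO hy)
  have h : ∃ l : List ℕ, (∀ a ∈ l, a ≤ r) ∧ wordAct r l.reverse y ∈ CplusCl r ∧
      ∀ l' : List ℕ, (∀ a ∈ l', a ≤ r) → wordAct r l'.reverse y ∈ CplusCl r →
        l.length ≤ l'.length := by
    refine ⟨l, hl.1, ?_, fun l' h1 h2 => hl.2.2 l' h1 (back l' h1 h2)⟩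
    rw [← hl.2.1, wordAct_reverse hr l hl.1]; exact hc
  rw [gW, dif_pos h]
  obtain ⟨h1, h2, h3⟩ := h.choose_spec
  refine ⟨h1, back _ h1 h2, fun l' h1' h2' => h3 l' h1' ?_⟩
  rw [← h2', wordAct_reverse hr l' h1']; exact hc

theorem wlen_of_SWd {r : ℕ} {c y : E r} {l : List ℕ} (h : SWd c l y) :
    wlen r (fun z => wordAct r l z) = l.length := by
  apply le_antisymm
  · exact Nat.sInf_le ⟨l, h.1, rfl, rfl⟩
  · refine le_csInf ⟨_, l, h.1, rfl, rfl⟩ ?_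
    rintro n ⟨l', h1, rfl, h2⟩
    exact h.2.2 l' h1 (by rw [← h.2.1]; exact congrFun h2 c)

theorem Plt.qlt {r : ℕ} (hr : 2 ≤ r) {O : Set (E r)} (hO : IsOrbit r O) {y y' : E r} (hy : y ∈ O)
    (h : Plt (cpt r O) y' y) : y' ∈ O ∧ qlt r y' y := by
  obtain ⟨hcO, hc⟩ := cpt_spec hr hO
  have hg := gW_spec hr hO hy
  obtain ⟨l', hs, hl', hlen⟩ := h _ hg
  have hy' : y' ∈ O := by rw [← hl'.2.1]; exact orbit_genF hO hcO _ hl'.1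
  have hg' := gW_spec hr hO hy'
  refine ⟨hy', ⟨orbit_conn hr hO hy hy', gW r y, hg.1, rfl, ?_, l', hs, ?_, ?_⟩, ?_⟩
  · exact (wlen_of_SWd hg).symm
  · funext z; exact SWd.unique hr hc _ _ _ hl' hg' z
  · have : gfun r y' = fun z => wordAct r l' z := by
      funext z; exact SWd.unique hr hc _ _ _ hg' hl' z
    rw [this]; exact (wlen_of_SWd hl').symm
  · rintro rfl
    have := hg.2.2 l' hl'.1 hl'.2.1
    omega

/-! ### Part 4: the torus and the base points -/

theorem etaE_int (n : ℤ) : etaE n = if 2 ∣ n then (if 2 ≤ n then 1 else -1) else 0 := by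
  have h : (∃ m : ℤ, (n : ℝ) = 2 * m) ↔ 2 ∣ n := by
    constructor
    · rintro ⟨m, hm⟩; exact ⟨m, by exact_mod_cast hm⟩
    · rintro ⟨m, hm⟩; exact ⟨m, by exact_mod_cast hm⟩
  have h2 : (2 ≤ (n : ℝ)) ↔ 2 ≤ n := by exact_mod_cast Iff.rfl
  simp only [etaE, h, h2]

theorem etaO_int (n : ℤ) : etaO n = if 2 ∣ n then 0 else (if 1 ≤ n then 1 else -1) := by
  have h : (∃ m : ℤ, (n : ℝ) = 2 * m + 1) ↔ ¬ 2 ∣ n := by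
    constructor
    · rintro ⟨m, hm⟩; have : n = 2 * m + 1 := by exact_mod_cast hm
      omega
    · intro hm
      refine ⟨n / 2, ?_⟩
      have : n = 2 * (n / 2) + 1 := by omega
      exact_mod_cast this
  have h2 : (1 ≤ (n : ℝ)) ↔ 1 ≤ n := by exact_mod_cast Iff.rfl
  simp only [etaO, h, h2]
  split_ifs <;> simp_all

theorem chiE_int (n : ℤ) : chiE n = if 2 ∣ n then 1 else 0 := by
  have h : (∃ m : ℤ, (n : ℝ) = 2 * m) ↔ 2 ∣ n := by
    constructor
    · rintro ⟨m, hm⟩; exact ⟨m, by exact_mod_cast hm⟩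
    · rintro ⟨m, hm⟩; exact ⟨m, by exact_mod_cast hm⟩
  simp only [chiE, h]

theorem chiO_int (n : ℤ) : chiO n = if 2 ∣ n then 0 else 1 := by
  have h : (∃ m : ℤ, (n : ℝ) = 2 * m + 1) ↔ ¬ 2 ∣ n := by
    constructor
    · rintro ⟨m, hm⟩; have : n = 2 * m + 1 := by exact_mod_cast hm
      omega
    · intro hm
      refine ⟨n / 2, ?_⟩
      have : n = 2 * (n / 2) + 1 := by omega
      exact_mod_cast this
  simp only [chiO, h]
  split_ifs <;> simp_all

theorem chiZ_int (n : ℤ) : chiZ n = 1 := by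
  rw [chiZ, if_pos ⟨n, rfl⟩]

theorem eta_int (n : ℤ) : eta n = if 1 ≤ n then 1 else -1 := by
  rw [eta, etaE_int, etaO_int]; split_ifs <;> omega

theorem etaE_non {z : ℝ} (h : ¬ ∃ n : ℤ, z = n) : etaE z = 0 := by
  rw [etaE, if_neg]; rintro ⟨n, hn⟩; exact h ⟨2 * n, by push_cast; exact hn⟩

theorem etaO_non {z : ℝ} (h : ¬ ∃ n : ℤ, z = n) : etaO z = 0 := by
  rw [etaO, if_neg]; rintro ⟨n, hn⟩; exact h ⟨2 * n + 1, by push_cast; exact hn⟩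

theorem chiE_non {z : ℝ} (h : ¬ ∃ n : ℤ, z = n) : chiE z = 0 := by
  rw [chiE, if_neg]; rintro ⟨n, hn⟩; exact h ⟨2 * n, by push_cast; exact hn⟩

theorem chiO_non {z : ℝ} (h : ¬ ∃ n : ℤ, z = n) : chiO z = 0 := by
  rw [chiO, if_neg]; rintro ⟨n, hn⟩; exact h ⟨2 * n + 1, by push_cast; exact hn⟩

theorem chiZ_non {z : ℝ} (h : ¬ ∃ n : ℤ, z = n) : chiZ z = 0 := by
  rw [chiZ, if_neg h]

theorem eta_non {z : ℝ} (h : ¬ ∃ n : ℤ, z = n) : eta z = 0 := by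
  rw [eta, etaE_non h, etaO_non h]; rfl

theorem nonint_neg {z : ℝ} (k : ℤ) (h : ¬ ∃ n : ℤ, z = n) : ¬ ∃ n : ℤ, k - z = n := by
  rintro ⟨n, hn⟩; exact h ⟨k - n, by push_cast; linarith⟩

theorem etaE_neg {z : ℝ} (hz : z ≠ 0) : etaE (-z) = -etaE z := by
  by_cases h : ∃ n : ℤ, z = n
  · obtain ⟨n, rfl⟩ := h
    have : n ≠ 0 := by rintro rfl; simp at hz
    rw [show -(n : ℝ) = ((-n : ℤ) : ℝ) by push_cast; ring, etaE_int, etaE_int]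
    split_ifs <;> omega
  · have := nonint_neg 0 h
    rw [show ((0 : ℤ) : ℝ) - z = -z by push_cast; ring] at this
    rw [etaE_non h, etaE_non this]; rfl

theorem etaO_neg (z : ℝ) : etaO (-z) = -etaO z := by
  by_cases h : ∃ n : ℤ, z = n
  · obtain ⟨n, rfl⟩ := h
    rw [show -(n : ℝ) = ((-n : ℤ) : ℝ) by push_cast; ring, etaO_int, etaO_int]
    split_ifs <;> omega
  · have := nonint_neg 0 h
    rw [show ((0 : ℤ) : ℝ) - z = -z by push_cast; ring] at this
    rw [etaO_non h, etaO_non this]; rfl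

theorem eta_neg {z : ℝ} (hz : z ≠ 0) : eta (-z) = -eta z := by
  rw [eta, eta, etaE_neg hz, etaO_neg]; ring

theorem eta_one_sub (z : ℝ) : eta (1 - z) = -eta z := by
  by_cases h : ∃ n : ℤ, z = n
  · obtain ⟨n, rfl⟩ := h
    rw [show 1 - (n : ℝ) = ((1 - n : ℤ) : ℝ) by push_cast; ring, eta_int, eta_int]
    split_ifs <;> omega
  · have := nonint_neg 1 h
    rw [show ((1 : ℤ) : ℝ) - z = 1 - z by push_cast; ring] at this
    rw [eta_non h, eta_non this]; rfl

theorem etaE_two_sub (z : ℝ) : etaE (2 - z) = -etaE z := by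
  by_cases h : ∃ n : ℤ, z = n
  · obtain ⟨n, rfl⟩ := h
    rw [show 2 - (n : ℝ) = ((2 - n : ℤ) : ℝ) by push_cast; ring, etaE_int, etaE_int]
    split_ifs <;> omega
  · have := nonint_neg 2 h
    rw [show ((2 : ℤ) : ℝ) - z = 2 - z by push_cast; ring] at this
    rw [etaE_non h, etaE_non this]; rfl

theorem etaO_two_sub {z : ℝ} (hz : z ≠ 1) : etaO (2 - z) = -etaO z := by
  by_cases h : ∃ n : ℤ, z = n
  · obtain ⟨n, rfl⟩ := h
    have : n ≠ 1 := by rintro rfl; simp at hz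
    rw [show 2 - (n : ℝ) = ((2 - n : ℤ) : ℝ) by push_cast; ring, etaO_int, etaO_int]
    split_ifs <;> omega
  · have := nonint_neg 2 h
    rw [show ((2 : ℤ) : ℝ) - z = 2 - z by push_cast; ring] at this
    rw [etaO_non h, etaO_non this]; rfl

/-- `nO` as a single sum -/
def psi {r : ℕ} (z : E r) (m j : Fin r) : ℤ :=
  if m < j then eta (z m - z j) + eta (z m + z j)
  else if j < m then eta (z j + z m) - eta (z j - z m) else 0

theorem nO_eq {r : ℕ} (z : E r) (m : Fin r) : nO r z m = ∑ j, psi z m j := by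
  rw [nO, ← Finset.sum_add_distrib]
  apply Finset.sum_congr rfl
  intro j _
  rcases lt_trichotomy m j with h | h | h
  · simp [psi, h, h.asymm]
  · subst h; simp [psi]
  · simp [psi, h, h.asymm]

theorem genF_zero_apply {r : ℕ} (y : E r) (m : Fin r) :
    genF r 0 y m = if (m : ℕ) = 0 then 1 - y m else y m := by simp [genF]

theorem genF_last_apply {r : ℕ} (hr : 2 ≤ r) (y : E r) (m : Fin r) :
    genF r r y m = if (m : ℕ) + 1 = r then - y m else y m := by
  have : r ≠ 0 := by omega
  simp [genF, this, sW]

theorem genF_mid_apply {r : ℕ} (a b : Fin r) (h : (b : ℕ) = a + 1) (y : E r) (m : Fin r) :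
    genF r (a + 1) y m = y (Equiv.swap a b m) := by
  have h1 : (a : ℕ) + 1 ≠ r := by have := b.2; omega
  simp only [genF, sW, h1, if_false, Nat.add_eq_zero_iff, one_ne_zero, and_false]
  rw [cd_fin, ← h, cd_fin]
  by_cases ha : m = a
  · subst ha; simp [h]
  by_cases hb : m = b
  · subst hb; simp [h]
  rw [Equiv.swap_apply_of_ne_of_ne ha hb]
  have h2 : (m : ℕ) ≠ b := fun e => hb (Fin.ext e)
  have h3 : (m : ℕ) ≠ a := fun e => ha (Fin.ext e)
  rw [if_neg (by omega), if_neg (by omega)]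

theorem sfrak_genF {F : Type*} [Field F] {r : ℕ} (hr : 2 ≤ r) (k0 u0 k kr ur : Fˣ) {a : ℕ}
    (ha : a ≤ r) (z : E r) (hz : aff (abarR r a) (nz a) z ≠ 0) (m : Fin r) :
    ∃ (j : Fin r) (ε n : ℤ), (ε = 1 ∨ ε = -1) ∧ (∀ y, genF r a y m = ε * y j + n) ∧
      sfrak F r k0 u0 k kr ur (genF r a z) m = sfrak F r k0 u0 k kr ur z j ^ ε := by
  rcases j_cases ha with h | h | ⟨p, q, hpq, h⟩
  · subst h
    have h0 : 0 < r := by omega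
    rw [aff, abarR_zero h0, ip_smul_left, ip_eV] at hz
    simp only [nz, if_true] at hz
    by_cases hm : (m : ℕ) = 0
    · refine ⟨m, -1, 1, Or.inr rfl, fun y => ?_, ?_⟩
      · rw [genF_zero_apply, if_pos hm]; push_cast; ring
      · have hm' : m = ⟨0, h0⟩ := Fin.ext hm
        have hz1 : 2 * z m ≠ 1 := by
          rw [hm']; intro e; apply hz; push_cast; linarith
        have e1 : genF r 0 z m = 1 - z m := by rw [genF_zero_apply, if_pos hm]
        have e2 : nO r (genF r 0 z) m = - nO r z m := by
          rw [nO_eq, nO_eq, ← Finset.sum_neg_distrib]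
          apply Finset.sum_congr rfl
          intro j _
          have hj : ¬ j < m := by simp [Fin.lt_def, hm]
          simp only [psi, hj, if_false]
          split_ifs with hmj
          · have hj0 : (j : ℕ) ≠ 0 := by simp [Fin.lt_def, hm] at hmj; omega
            rw [e1, genF_zero_apply, if_neg hj0,
              show 1 - z m - z j = 1 - (z m + z j) by ring, eta_one_sub,
              show 1 - z m + z j = 1 - (z m - z j) by ring, eta_one_sub]; ring
          · rfl
        simp only [sfrak]
        rw [e2, e1, show 2 * (1 - z m) = 2 - 2 * z m by ring, etaE_two_sub, etaO_two_sub hz1]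
        simp only [zpow_neg, zpow_one, mul_inv_rev]
        simp only [mul_comm]
    · refine ⟨m, 1, 0, Or.inl rfl, fun y => ?_, ?_⟩
      · rw [genF_zero_apply, if_neg hm]; push_cast; ring
      · have e1 : genF r 0 z m = z m := by rw [genF_zero_apply, if_neg hm]
        have e2 : nO r (genF r 0 z) m = nO r z m := by
          rw [nO_eq, nO_eq]
          apply Finset.sum_congr rfl
          intro j _
          simp only [psi, e1]
          by_cases hj : (j : ℕ) = 0
          · have h1 : ¬ m < j := by simp [Fin.lt_def, hj]
            have h2 : j < m := by simp [Fin.lt_def, hj]; omega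
            simp only [h1, h2, if_true, if_false]
            rw [genF_zero_apply, if_pos hj,
              show 1 - z j + z m = 1 - (z j - z m) by ring, eta_one_sub,
              show 1 - z j - z m = 1 - (z j + z m) by ring, eta_one_sub]; ring
          · rw [genF_zero_apply, if_neg hj]
        simp only [sfrak, e1, e2, zpow_one]
  · subst h
    have h0 : a - 1 < a := by omega
    have hne : a ≠ 0 := by omega
    rw [aff, abarR_last h0, ip_smul_left, ip_eV] at hz
    simp only [nz, hne, if_false] at hz
    by_cases hm : (m : ℕ) + 1 = a
    · refine ⟨m, -1, 0, Or.inr rfl, fun y => ?_, ?_⟩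
      · rw [genF_last_apply hr, if_pos hm]; push_cast; ring
      · have hm' : m = ⟨a - 1, h0⟩ := Fin.ext (by simp; omega)
        have hz1 : 2 * z m ≠ 0 := by
          rw [hm']; intro e; apply hz; push_cast; linarith
        have e1 : genF a a z m = - z m := by rw [genF_last_apply hr, if_pos hm]
        have e2 : nO a (genF a a z) m = - nO a z m := by
          rw [nO_eq, nO_eq, ← Finset.sum_neg_distrib]
          apply Finset.sum_congr rfl
          intro j _
          have hj : ¬ m < j := by simp only [Fin.lt_def]; have := j.2; omega
          simp only [psi, hj, if_false]
          split_ifs with hmj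
          · have hj0 : (j : ℕ) + 1 ≠ a := by simp only [Fin.lt_def] at hmj; omega
            rw [e1, genF_last_apply hr, if_neg hj0, sub_neg_eq_add, ← sub_eq_add_neg]; ring
          · rfl
        simp only [sfrak]
        rw [e2, e1, show 2 * (- z m) = - (2 * z m) by ring, etaE_neg hz1, etaO_neg]
        simp only [zpow_neg, zpow_one, mul_inv_rev]
        simp only [mul_comm]
    · refine ⟨m, 1, 0, Or.inl rfl, fun y => ?_, ?_⟩
      · rw [genF_last_apply hr, if_neg hm]; push_cast; ring
      · have e1 : genF a a z m = z m := by rw [genF_last_apply hr, if_neg hm]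
        have e2 : nO a (genF a a z) m = nO a z m := by
          rw [nO_eq, nO_eq]
          apply Finset.sum_congr rfl
          intro j _
          simp only [psi, e1]
          by_cases hj : (j : ℕ) + 1 = a
          · have h1 : m < j := by simp only [Fin.lt_def]; have := m.2; omega
            simp only [h1, if_true]
            rw [genF_last_apply hr, if_pos hj, sub_neg_eq_add, ← sub_eq_add_neg]; ring
          · rw [genF_last_apply hr, if_neg hj]
        simp only [sfrak, e1, e2, zpow_one]
  · subst h
    refine ⟨Equiv.swap p q m, 1, 0, Or.inl rfl, fun y => ?_, ?_⟩
    · rw [genF_mid_apply p q hpq]; push_cast; ring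
    · rw [aff, abarR_mid p q hpq, ip_sub_left, ip_eV, ip_eV] at hz
      simp only [nz, Nat.add_eq_zero_iff, one_ne_zero, and_false, if_false] at hz
      have hz1 : z p - z q ≠ 0 := by intro e; apply hz; push_cast; linarith
      have e1 : ∀ m, genF r (p + 1) z m = z (Equiv.swap p q m) := fun m => genF_mid_apply p q hpq z m
      have hpqne : p ≠ q := by rintro rfl; omega
      have e2 : nO r (genF r (p + 1) z) m = nO r z (Equiv.swap p q m) := by
        rw [nO_eq, nO_eq, ← Equiv.sum_comp (Equiv.swap p q)]
        apply Finset.sum_congr rfl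
        intro j _
        simp only [psi, e1, Equiv.swap_apply_self]
        rw [show z j = z j from rfl]
        have lt1 : p < q := by simp only [Fin.lt_def]; omega
        by_cases hmp : m = p
        · subst hmp
          rw [Equiv.swap_apply_left]
          by_cases hj1 : j = m
          · subst hj1
            rw [Equiv.swap_apply_left]
            simp only [lt1, lt1.not_gt, if_true, if_false]
            rw [show z q - z j = -(z j - z q) by ring, eta_neg hz1, add_comm (z q) (z j)]; ring
          by_cases hj2 : j = q
          · subst hj2
            rw [Equiv.swap_apply_right]; simp
          rw [Equiv.swap_apply_of_ne_of_ne hj1 hj2]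
          have n1 : (j : ℕ) ≠ m := fun e => hj1 (Fin.ext e)
          have n2 : (j : ℕ) ≠ q := fun e => hj2 (Fin.ext e)
          have i1 : m < j ↔ q < j := by simp only [Fin.lt_def]; omega
          have i2 : j < m ↔ j < q := by simp only [Fin.lt_def]; omega
          simp only [i1, i2]
        by_cases hmq : m = q
        · subst hmq
          rw [Equiv.swap_apply_right]
          by_cases hj1 : j = p
          · subst hj1
            rw [Equiv.swap_apply_left]; simp
          by_cases hj2 : j = m
          · subst hj2
            rw [Equiv.swap_apply_right]
            simp only [lt1, lt1.not_gt, if_true, if_false]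
            rw [show z j - z p = -(z p - z j) by ring, eta_neg hz1, add_comm (z j) (z p)]; ring
          rw [Equiv.swap_apply_of_ne_of_ne hj1 hj2]
          have n1 : (j : ℕ) ≠ m := fun e => hj2 (Fin.ext e)
          have n2 : (j : ℕ) ≠ p := fun e => hj1 (Fin.ext e)
          have i1 : m < j ↔ p < j := by simp only [Fin.lt_def]; omega
          have i2 : j < m ↔ j < p := by simp only [Fin.lt_def]; omega
          simp only [i1, i2]
        rw [Equiv.swap_apply_of_ne_of_ne hmp hmq]
        have n1 : (m : ℕ) ≠ p := fun e => hmp (Fin.ext e)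
        have n2 : (m : ℕ) ≠ q := fun e => hmq (Fin.ext e)
        have i1 : m < Equiv.swap p q j ↔ m < j := by
          by_cases hj1 : j = p
          · subst hj1; rw [Equiv.swap_apply_left]; simp only [Fin.lt_def]; omega
          by_cases hj2 : j = q
          · subst hj2; rw [Equiv.swap_apply_right]; simp only [Fin.lt_def]; omega
          rw [Equiv.swap_apply_of_ne_of_ne hj1 hj2]
        have i2 : Equiv.swap p q j < m ↔ j < m := by
          by_cases hj1 : j = p
          · subst hj1; rw [Equiv.swap_apply_left]; simp only [Fin.lt_def]; omega
          by_cases hj2 : j = q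
          · subst hj2; rw [Equiv.swap_apply_right]; simp only [Fin.lt_def]; omega
          rw [Equiv.swap_apply_of_ne_of_ne hj1 hj2]
        simp only [i1, i2]
      simp only [sfrak, e1, e2, zpow_one]

theorem sfrak_cpt {F : Type*} [Field F] {r : ℕ} (hr : 2 ≤ r) {O : Set (E r)} (hO : IsOrbit r O)
    (k0 u0 k kr ur : Fˣ) (m : Fin r) :
    sfrak F r k0 u0 k kr ur (cpt r O) m = sOtor F r k0 u0 k kr ur O m := by
  obtain ⟨_, _, hc⟩ := cpt_spec hr hO
  have hm := hc m
  have h1 : etaE (2 * cpt r O m) = -(chiE (2 * cpt r O m) : ℤ) := by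
    by_cases h : ∃ n : ℤ, 2 * cpt r O m = n
    · obtain ⟨n, hn⟩ := h
      have : n ≤ 1 := by
        have : (n : ℝ) ≤ 1 := by linarith
        exact_mod_cast this
      rw [hn, etaE_int, chiE_int]; split_ifs <;> omega
    · rw [etaE_non h, chiE_non h]; rfl
  have h2 : etaO (2 * cpt r O m) = (chiO (2 * cpt r O m) : ℤ) := by
    by_cases h : ∃ n : ℤ, 2 * cpt r O m = n
    · obtain ⟨n, hn⟩ := h
      have : 0 ≤ n := by
        have : (0 : ℝ) ≤ n := by linarith
        exact_mod_cast this
      rw [hn, etaO_int, chiO_int]; split_ifs <;> omega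
    · rw [etaO_non h, chiO_non h]; rfl
  simp only [sfrak, sOtor, h1, h2]

theorem sfrak_word {F : Type*} [Field F] {r : ℕ} (hr : 2 ≤ r) (k0 u0 k kr ur : Fˣ) {c : E r}
    (hc : c ∈ CplusCl r) (l : List ℕ) : ∀ y, SWd c l y → ∀ m : Fin r,
    ∃ (j : Fin r) (ε n : ℤ), (ε = 1 ∨ ε = -1) ∧ (∀ y, wordAct r l y m = ε * y j + n) ∧
      sfrak F r k0 u0 k kr ur y m = sfrak F r k0 u0 k kr ur c j ^ ε := by
  induction l with
  | nil =>
    intro y hy m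
    refine ⟨m, 1, 0, Or.inl rfl, fun y => by simp [wordAct], ?_⟩
    have : c = y := hy.2.1
    rw [this]; simp
  | cons a l ih =>
    intro y hy m
    have ha : a ≤ r := hy.1 a (by simp)
    have h1 := SWd.tail hr hy
    have h2 := SWd.head_neg hr hc hy
    have hyz : y = genF r a (wordAct r l c) := hy.2.1.symm
    have h3 : aff (abarR r a) (nz a) (wordAct r l c) ≠ 0 := by
      intro h
      have e : genF r a (wordAct r l c) = wordAct r l c := by
        rw [genF_eq hr ha, srt, h]; simp
      rw [hyz, e] at h2; linarith
    obtain ⟨j, ε, n, hε, hg, hs⟩ := sfrak_genF (F := F) hr k0 u0 k kr ur ha _ h3 m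
    have h1' : SWd c l (wordAct r l c) := by
      refine ⟨fun b hb => hy.1 b (by simp [hb]), rfl, ?_⟩
      first
        | exact h1.2.2
        | (have e : genF r a y = wordAct r l c := by rw [hyz, genF_genF hr ha]
           rw [← e]; exact h1.2.2)
    obtain ⟨j', ε', n', hε', hg', hs'⟩ := ih _ h1' j
    refine ⟨j', ε * ε', ε * n' + n, ?_, fun y => ?_, ?_⟩
    · rcases hε with rfl | rfl <;> rcases hε' with rfl | rfl <;> simp
    · show genF r a (wordAct r l y) m = _
      rw [hg, hg']; push_cast; ring
    · rw [hyz, hs, hs', ← zpow_mul, mul_comm]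

theorem tcU_fin {F : Type*} [Field F] {r : ℕ} (t : Fin r → Fˣ) (m : Fin r) :
    tcU F r t (m + 1) = t m := by
  rw [tcU, Finset.prod_eq_single m]
  · simp
  · intro b _ hb
    have : (b : ℕ) ≠ m := fun e => hb (Fin.ext e)
    simp [this]
  · simp

theorem torusAct_coord {F : Type*} [Field F] {r : ℕ} (qh : Fˣ) (t : Fin r → Fˣ) {g : E r → E r}
    {m j : Fin r} {ε n : ℤ} (h : ∀ y, g y m = ε * y j + n) :
    torusAct F r qh g t m = (qh * qh) ^ n * t j ^ ε := by
  rw [torusAct, h 0]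
  congr 1
  · simp
  · rw [Finset.prod_eq_single j]
    · rw [Pi.sub_apply, h, h]; simp [eV]
    · intro b _ hb
      rw [Pi.sub_apply, h, h]; simp [eV, hb.symm]
    · simp

section TO
variable {F : Type*} [Field F] {r : ℕ} {qh : Fˣ} {O : Set (E r)} {t : Fin r → Fˣ}

theorem TO_eq (hr : 2 ≤ r) (hO : IsOrbit r O) (ht : t ∈ TOset F r qh O) (a b : Fin r)
    (h : cpt r O a = cpt r O b) : t a = t b := by
  obtain ⟨_, hmono, hc⟩ := cpt_spec hr hO
  have main : ∀ n : ℕ, ∀ a b : Fin r, (b : ℕ) = a + n → cpt r O a = cpt r O b → t a = t b := by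
    intro n
    induction n with
    | zero => intro a b hab _; rw [show a = b from Fin.ext (by omega)]
    | succ n ih =>
      intro a b hab h
      have hb := b.2
      let a' : Fin r := ⟨a + 1, by omega⟩
      have h1 : cpt r O a' ≤ cpt r O a := hmono a a' (by simp [Fin.le_def, a'])
      have h2 : cpt r O b ≤ cpt r O a' := hmono a' b (by simp [Fin.le_def, a']; omega)
      rw [← ih a' b (by simp [a']; omega) (by linarith)]
      have h3 := ht (a + 1) (by omega) (by
        have e : (a : ℕ) + 1 ≠ r := by omega
        simp only [alphaF, e, if_false, Nat.add_eq_zero_iff, one_ne_zero, and_false]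
        rw [cd_fin, show (a : ℕ) + 1 + 1 = a' + 1 from rfl, cd_fin]; linarith)
      have e : (a : ℕ) + 1 ≠ r := by omega
      simp only [tpowCo, e, if_false, Nat.add_eq_zero_iff, one_ne_zero, and_false] at h3
      rw [tcU_fin, show (a : ℕ) + 1 + 1 = a' + 1 from rfl, tcU_fin] at h3
      exact mul_inv_eq_one.1 h3
  rcases le_total (a : ℕ) b with hab | hab
  · exact main (b - a) a b (by omega) h
  · exact (main (a - b) b a (by omega) h.symm).symm

theorem TO_zero (hr : 2 ≤ r) (hO : IsOrbit r O) (ht : t ∈ TOset F r qh O) (a : Fin r)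
    (h : cpt r O a = 0) : t a = 1 := by
  obtain ⟨_, hmono, hc⟩ := cpt_spec hr hO
  let b : Fin r := ⟨r - 1, by omega⟩
  have hb : (b : ℕ) + 1 = r := by simp [b]; omega
  have h1 : cpt r O b = 0 :=
    le_antisymm (h ▸ hmono a b (by simp only [Fin.le_def]; have := a.2; omega)) (hc b).1
  rw [TO_eq hr hO ht a b (by rw [h, h1])]
  have h0 : r ≠ 0 := by omega
  have h3 := ht r le_rfl (by
    simp only [alphaF, h0, if_false, if_true]
    conv_lhs => rw [show cd r (cpt r O) r = cd r (cpt r O) (b + 1) by rw [hb]]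
    rw [cd_fin, h1]; simp)
  simp only [tpowCo, h0, if_false, if_true] at h3
  rw [show tcU F r t r = tcU F r t (b + 1) by rw [hb], tcU_fin] at h3
  exact h3

theorem TO_half (hr : 2 ≤ r) (hO : IsOrbit r O) (ht : t ∈ TOset F r qh O) (a : Fin r)
    (h : cpt r O a = 1 / 2) : t a = qh := by
  obtain ⟨_, hmono, hc⟩ := cpt_spec hr hO
  let b : Fin r := ⟨0, by omega⟩
  have h1 : cpt r O b = 1 / 2 :=
    le_antisymm (hc b).2 (h ▸ hmono b a (by simp [Fin.le_def, b]))
  rw [TO_eq hr hO ht a b (by rw [h, h1])]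
  have h3 := ht 0 (by omega) (by
    simp only [alphaF, if_true]
    rw [show (1 : ℕ) = b + 1 from rfl, cd_fin, h1]; norm_num)
  simp only [tpowCo, if_true] at h3
  rw [show (1 : ℕ) = b + 1 from rfl, tcU_fin] at h3
  exact (mul_inv_eq_one.1 h3).symm

theorem TO_rel (hr : 2 ≤ r) (hO : IsOrbit r O) (ht : t ∈ TOset F r qh O) {j j' : Fin r}
    {ε ε' n n' : ℤ} (hε : ε = 1 ∨ ε = -1) (hε' : ε' = 1 ∨ ε' = -1)
    (h : (ε : ℝ) * cpt r O j + n = ε' * cpt r O j' + n') :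
    (qh * qh) ^ n * t j ^ ε = (qh * qh) ^ n' * t j' ^ ε' := by
  obtain ⟨_, _, hc⟩ := cpt_spec hr hO
  have hj := hc j
  have hj' := hc j'
  -- the mixed case
  have mixed : ∀ (a b : Fin r) (n n' : ℤ), cpt r O a + n = - cpt r O b + n' →
      (qh * qh) ^ n * t a = (qh * qh) ^ n' * (t b)⁻¹ := by
    intro a b n n' h
    have ha := hc a
    have hb := hc b
    have h0 : (0 : ℝ) ≤ (n' - n : ℤ) := by push_cast; linarith
    have h1 : ((n' - n : ℤ) : ℝ) ≤ 1 := by push_cast; linarith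
    have h0' : 0 ≤ n' - n := by exact_mod_cast h0
    have h1' : n' - n ≤ 1 := by exact_mod_cast h1
    rcases (by omega : n' = n ∨ n' = n + 1) with e | e
    · subst e
      rw [TO_zero hr hO ht a (by linarith), TO_zero hr hO ht b (by linarith)]; simp
    · subst e
      push_cast at h
      rw [TO_half hr hO ht a (by linarith), TO_half hr hO ht b (by linarith), zpow_add_one]
      group
  rcases hε with rfl | rfl <;> rcases hε' with rfl | rfl
  · push_cast at h
    have h1 : (-1 : ℝ) < (n' - n : ℤ) := by push_cast; linarith
    have h2 : ((n' - n : ℤ) : ℝ) < 1 := by push_cast; linarith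
    have h1' : -1 < n' - n := by exact_mod_cast h1
    have h2' : n' - n < 1 := by exact_mod_cast h2
    have : n' = n := by omega
    subst this
    rw [TO_eq hr hO ht j j' (by linarith)]
  · push_cast at h
    have := mixed j j' n n' (by linarith)
    simpa using this
  · push_cast at h
    have := mixed j' j n' n (by linarith)
    simpa using this.symm
  · push_cast at h
    have h1 : (-1 : ℝ) < (n' - n : ℤ) := by push_cast; linarith
    have h2 : ((n' - n : ℤ) : ℝ) < 1 := by push_cast; linarith
    have h1' : -1 < n' - n := by exact_mod_cast h1
    have h2' : n' - n < 1 := by exact_mod_cast h2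
    have : n' = n := by omega
    subst this
    rw [TO_eq hr hO ht j j' (by linarith)]

/-- `(g_y t)_m` -/
def Th (F : Type*) [Field F] (r : ℕ) (qh : Fˣ) (t : Fin r → Fˣ) (y : E r) (m : Fin r) : Fˣ :=
  torusAct F r qh (gfun r y) t m

theorem Th_inv (hr : 2 ≤ r) (hO : IsOrbit r O) (ht : t ∈ TOset F r qh O) {y z : E r}
    (hy : y ∈ O) (hz : z ∈ O) (m m' : Fin r) (h : z m = - y m') :
    Th F r qh t z m = (Th F r qh t y m')⁻¹ := by
  have gy := gW_spec hr hO hy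
  have gz := gW_spec hr hO hz
  obtain ⟨j, ε, n, hε, h1⟩ := wordAct_coord hr _ gz.1 m
  obtain ⟨j', ε', n', hε', h1'⟩ := wordAct_coord hr _ gy.1 m'
  rw [Th, Th, torusAct_coord qh t (g := gfun r z) h1, torusAct_coord qh t (g := gfun r y) h1']
  rw [TO_rel hr hO ht (j' := j') (ε' := -ε') (n' := -n') hε (by omega), mul_inv, zpow_neg, zpow_neg]
  have e1 := h1 (cpt r O); have e2 := h1' (cpt r O)
  rw [gz.2.1] at e1; rw [gy.2.1] at e2
  push_cast; rw [← e1, h, e2]; ring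

theorem Th_half (hr : 2 ≤ r) (hO : IsOrbit r O) (ht : t ∈ TOset F r qh O) {z : E r}
    (hz : z ∈ O) (m : Fin r) (N : ℤ) (h : 2 * z m = N) :
    Th F r qh t z m = qh ^ N := by
  obtain ⟨_, _, hc⟩ := cpt_spec hr hO
  have gz := gW_spec hr hO hz
  obtain ⟨j, ε, n, hε, h1⟩ := wordAct_coord hr _ gz.1 m
  rw [Th, torusAct_coord qh t (g := gfun r z) h1]
  have e1 := h1 (cpt r O)
  rw [gz.2.1] at e1
  have hj := hc j
  have e2 : (2 * cpt r O j : ℝ) = (ε * (N - 2 * n) : ℤ) := by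
    rcases hε with rfl | rfl <;> push_cast at e1 ⊢ <;> linarith
  have h0 : (0 : ℝ) ≤ (ε * (N - 2 * n) : ℤ) := by rw [← e2]; linarith
  have h1 : ((ε * (N - 2 * n) : ℤ) : ℝ) ≤ 1 := by rw [← e2]; linarith
  have h0' : 0 ≤ (ε * (N - 2 * n) : ℤ) := by exact_mod_cast h0
  have h1' : (ε * (N - 2 * n) : ℤ) ≤ 1 := by exact_mod_cast h1
  rcases (by omega : (ε * (N - 2 * n) : ℤ) = 0 ∨ (ε * (N - 2 * n) : ℤ) = 1) with e | e
  · rw [e] at e2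
    rw [TO_zero hr hO ht j (by push_cast at e2; linarith)]
    have : N = n + n := by rcases hε with rfl | rfl <;> omega
    rw [this, mul_zpow, zpow_add]; simp
  · rw [e] at e2
    rw [TO_half hr hO ht j (by push_cast at e2; linarith)]
    have : N = n + n + ε := by rcases hε with rfl | rfl <;> omega
    rw [this, mul_zpow, zpow_add, zpow_add]

theorem gammaO_eq (hr : 2 ≤ r) (hO : IsOrbit r O) (k0 u0 k kr ur : Fˣ) {y : E r} (hy : y ∈ O)
    (m : Fin r) : gammaO F r qh k0 u0 k kr ur O t (m + 1) y =
      (sfrak F r k0 u0 k kr ur y m)⁻¹ * (Th F r qh t y m)⁻¹ := by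
  have hc := (cpt_spec hr hO).2
  obtain ⟨j, ε, n, hε, h1, h2⟩ := sfrak_word (F := F) hr k0 u0 k kr ur hc _ _ (gW_spec hr hO hy) m
  rw [gammaO, tcU_fin, torusAct_coord qh _ (g := gfun r y) h1, Th,
    torusAct_coord qh t (g := gfun r y) h1, h2, sfrak_cpt hr hO, ← mul_inv,
    mul_zpow (sOtor F r k0 u0 k kr ur O j), mul_left_comm]
end TO

/-! ### Part 5: the operators on monomials -/

section ops
variable {F : Type*} [Field F] {r : ℕ}

theorem X_mul (a b : E r) : X F r a * X F r b = X F r (a + b) := by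
  rw [X, X, X, AddMonoidAlgebra.single_mul_single, one_mul]

theorem mkOp_X (Ψ : E r → QA F r) (z : E r) : mkOp F r Ψ (X F r z) = Ψ z := by
  rw [mkOp, X]
  simp [AddMonoidAlgebra.coeffLinearEquiv]

theorem geomS_pos {c : F} {v z : E r} {M : ℤ} (S : Submodule F (QA F r)) (hM : 0 ≤ M)
    (h : ∀ t : ℤ, 0 ≤ t → t < M → X F r (z + (t : ℝ) • v) ∈ S) :
    geomS F r c v M * X F r z ∈ S := by
  rw [geomS, if_pos hM, Finset.sum_mul]
  refine Submodule.sum_mem _ fun t ht => ?_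
  rw [smul_mul_assoc, X_mul, add_comm]
  refine S.smul_mem _ ?_
  have := h t (by positivity) (by have := Finset.mem_range.1 ht; omega)
  simpa using this

theorem geomS_pos_lead {c : F} {v z : E r} {M : ℤ} (S : Submodule F (QA F r)) (hM : 0 < M)
    (h : ∀ t : ℤ, 0 < t → t < M → X F r (z + (t : ℝ) • v) ∈ S) :
    geomS F r c v M * X F r z - X F r z ∈ S := by
  rw [geomS, if_pos hM.le, Finset.sum_mul]
  obtain ⟨n, hn⟩ : ∃ n : ℕ, M.toNat = n + 1 := ⟨M.toNat - 1, by omega⟩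
  rw [hn, Finset.sum_range_succ']
  have e : c ^ ((0 : ℕ) : ℤ) • X F r (((0 : ℕ) : ℝ) • v) * X F r z = X F r z := by
    rw [smul_mul_assoc, X_mul]; simp
  rw [e, add_sub_cancel_right]
  refine Submodule.sum_mem _ fun t ht => ?_
  rw [smul_mul_assoc, X_mul, add_comm _ z]
  refine S.smul_mem _ ?_
  have := h ((t + 1 : ℕ) : ℤ) (by positivity) (by have := Finset.mem_range.1 ht; omega)
  simpa using this

theorem geomS_neg_lead {c : F} {v z : E r} {M : ℤ} (S : Submodule F (QA F r)) (hM : M < 0)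
    (h : ∀ t : ℤ, M < t → t < 0 → X F r (z + (t : ℝ) • v) ∈ S) :
    geomS F r c v M * X F r z + c ^ M • X F r (z + (M : ℝ) • v) ∈ S := by
  rw [geomS, if_neg (by omega)]
  obtain ⟨n, hn⟩ : ∃ n : ℕ, (-M).toNat = n + 1 := ⟨(-M).toNat - 1, by omega⟩
  have hMn : M = -(n : ℤ) - 1 := by omega
  rw [hn, Finset.sum_range_succ, neg_mul, add_mul]
  have e : c ^ (-(n : ℤ) - 1) • X F r ((-(n : ℝ) - 1) • v) * X F r z
      = c ^ M • X F r (z + (M : ℝ) • v) := by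
    rw [smul_mul_assoc, X_mul, add_comm, hMn]; push_cast; rfl
  rw [e, neg_add, add_assoc, neg_add_cancel, add_zero, Finset.sum_mul]
  refine S.neg_mem (Submodule.sum_mem _ fun t ht => ?_)
  rw [smul_mul_assoc, X_mul, add_comm]
  refine S.smul_mem _ ?_
  have := h (-(t : ℤ) - 1) (by have := Finset.mem_range.1 ht; omega) (by omega)
  simpa using this

theorem geomS_neg {c : F} {v z : E r} {M : ℤ} (S : Submodule F (QA F r)) (hM : M < 0)
    (h : ∀ t : ℤ, M ≤ t → t < 0 → X F r (z + (t : ℝ) • v) ∈ S) :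
    geomS F r c v M * X F r z ∈ S := by
  have h1 := geomS_neg_lead (c := c) S hM (fun t h1 h2 => h t h1.le h2)
  have h2 := S.smul_mem (c ^ M) (h M le_rfl hM)
  simpa using S.sub_mem h1 h2

def LowT (α : ℝ) (m : ℤ) : Prop := (0 < m ∧ (m : ℝ) < α) ∨ (α < m ∧ m ≤ 0)
def LowI (α : ℝ) (m : ℤ) : Prop := (0 ≤ m ∧ (m : ℝ) < α) ∨ (α < m ∧ m < 0)

def SpL (F : Type*) [Field F] {r : ℕ} (P : ℤ → Prop) (v z : E r) : Submodule F (QA F r) :=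
  Submodule.span F {p | ∃ m : ℤ, P m ∧ p = X F r (z - (m : ℝ) • v)}

theorem mem_SpL {P : ℤ → Prop} {v z w : E r} (m : ℤ) (hm : P m) (hw : w = z - (m : ℝ) • v) :
    X F r w ∈ SpL F P v z := Submodule.subset_span ⟨m, hm, by rw [hw]⟩

theorem floorE_half (α : ℝ) : -floorE α / 2 = -⌊α / 2⌋ := by
  rw [floorE]; omega
theorem floorO_half (α : ℝ) : (-floorO α - 1) / 2 = -⌊(α + 1) / 2⌋ := by
  rw [floorO]; omega

theorem vec1 (v z : E r) (t : ℤ) : z + (t : ℝ) • v = z - ((-t : ℤ) : ℝ) • v := by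
  push_cast; rw [neg_smul, sub_neg_eq_add]
theorem vec2 (v z : E r) (t : ℤ) : z + (t : ℝ) • ((2 : ℝ) • v) = z - ((-(2 * t) : ℤ) : ℝ) • v := by
  push_cast; rw [neg_smul, sub_neg_eq_add, smul_smul, mul_comm]
theorem vec3 (v z : E r) (t : ℤ) :
    z + v + (t : ℝ) • ((2 : ℝ) • v) = z - ((-(2 * t) - 1 : ℤ) : ℝ) • v := by
  push_cast; module

/-- middle operator, noncritical -/
theorem Nm_mem {c : F} {v z : E r} {α : ℝ} (h : ¬ ∃ n : ℤ, 1 ≤ n ∧ α = n) :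
    geomS F r c v (-⌊α⌋) * X F r z ∈ SpL F (LowT α) v z := by
  have h1 := Int.floor_le α
  have h2 := Int.lt_floor_add_one α
  by_cases h0 : 0 ≤ -⌊α⌋
  · refine geomS_pos _ h0 fun t ht1 ht2 => mem_SpL (-t) (Or.inr ⟨?_, by omega⟩) (vec1 _ _ _)
    have : (⌊α⌋ : ℝ) + 1 ≤ ((-t : ℤ) : ℝ) := by exact_mod_cast (by omega : ⌊α⌋ + 1 ≤ -t)
    linarith
  · refine geomS_neg _ (by omega) fun t ht1 ht2 =>
      mem_SpL (-t) (Or.inl ⟨by omega, ?_⟩) (vec1 _ _ _)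
    have h3 : ((-t : ℤ) : ℝ) ≤ ⌊α⌋ := by exact_mod_cast (by omega : -t ≤ ⌊α⌋)
    refine lt_of_le_of_ne (h3.trans h1) fun e => h ⟨-t, by omega, e.symm⟩

theorem Nm_lead {v z : E r} {n : ℤ} (h : 1 ≤ n) :
    geomS F r 1 v (-⌊(n : ℝ)⌋) * X F r z + X F r (z - (n : ℝ) • v) ∈ SpL F (LowT n) v z := by
  rw [Int.floor_intCast]
  have := geomS_neg_lead (c := (1 : F)) (v := v) (z := z) (M := -n) (SpL F (LowT n) v z) (by omega)
    fun t ht1 ht2 => mem_SpL (-t) (Or.inl ⟨by omega, by exact_mod_cast (by omega : -t < n)⟩)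
      (vec1 _ _ _)
  rw [one_zpow, one_smul, vec1, neg_neg] at this
  exact this

theorem LowT_I {α : ℝ} (h : 0 ≤ α) (m : ℤ) (hm : LowT α m) : LowI α m := by
  rcases hm with ⟨h1, h2⟩ | ⟨h1, h2⟩
  · exact Or.inl ⟨h1.le, h2⟩
  · have : (m : ℝ) ≤ 0 := by exact_mod_cast h2
    linarith

theorem SpL_mono {P Q : ℤ → Prop} (h : ∀ m, P m → Q m) (v z : E r) : SpL F P v z ≤ SpL F Q v z := by
  apply Submodule.span_mono
  rintro p ⟨m, hm, rfl⟩; exact ⟨m, h m hm, rfl⟩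

/-- middle operator, inverse version for negative `α` -/
theorem Nm_inv {v z : E r} {α : ℝ} (h : α < 0) :
    geomS F r 1 v (-⌊α⌋) * X F r z - X F r z ∈ SpL F (LowI α) v z := by
  have h1 := Int.floor_le α
  have h2 := Int.lt_floor_add_one α
  have h0 : ⌊α⌋ < 0 := Int.floor_lt.2 (by exact_mod_cast h)
  refine geomS_pos_lead _ (by omega) fun t ht1 ht2 =>
    mem_SpL (-t) (Or.inr ⟨?_, by omega⟩) (vec1 _ _ _)
  have : (⌊α⌋ : ℝ) + 1 ≤ ((-t : ℤ) : ℝ) := by exact_mod_cast (by omega : ⌊α⌋ + 1 ≤ -t)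
  linarith

theorem Tmid_gen (k : Fˣ) (v z : E r) (α : ℝ) :
    (k : F) ^ chiZ α • X F r (z - α • v) + ((k : F) - (k : F)⁻¹) •
      (geomS F r 1 v (-⌊α⌋) * X F r z) - ((k ^ (-eta α) : Fˣ) : F) • X F r (z - α • v)
      ∈ SpL F (LowT α) v z := by
  by_cases h : ∃ n : ℤ, 1 ≤ n ∧ α = n
  · obtain ⟨n, h1, rfl⟩ := h
    rw [chiZ_int, eta_int, if_pos h1]
    convert (SpL F (LowT n) v z).smul_mem ((k : F) - (k : F)⁻¹) (Nm_lead h1) using 1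
    rw [smul_add, sub_smul _ _ (X F r (z - (n : ℝ) • v))]
    simp; abel
  · have h1 := (SpL F (LowT α) v z).smul_mem ((k : F) - (k : F)⁻¹) (Nm_mem (c := 1) h)
    convert h1 using 1
    by_cases h2 : ∃ n : ℤ, α = n
    · obtain ⟨n, rfl⟩ := h2
      have : ¬ 1 ≤ n := fun e => h ⟨n, e, rfl⟩
      rw [chiZ_int, eta_int, if_neg this]; simp
    · rw [chiZ_non h2, eta_non h2]; simp

theorem Tinv_gen (k : Fˣ) (v z : E r) (α : ℝ) :
    (k : F) ^ chiZ α • X F r (z - α • v) + ((k : F) - (k : F)⁻¹) •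
      (geomS F r 1 v (-⌊α⌋) * X F r z) - ((k : F) - (k : F)⁻¹) • X F r z
      - ((k ^ (eta (-α)) : Fˣ) : F) • X F r (z - α • v)
      ∈ SpL F (LowI α) v z := by
  rcases lt_trichotomy α 0 with h | h | h
  · have h1 := (SpL F (LowI α) v z).smul_mem ((k : F) - (k : F)⁻¹) (Nm_inv h)
    convert h1 using 1
    have : (k : F) ^ chiZ α = ((k ^ (eta (-α)) : Fˣ) : F) := by
      by_cases h2 : ∃ n : ℤ, α = n
      · obtain ⟨n, rfl⟩ := h2
        have : n < 0 := by exact_mod_cast h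
        rw [chiZ_int, show -(n : ℝ) = ((-n : ℤ) : ℝ) by push_cast; rfl, eta_int, if_pos (by omega)]
        simp
      · rw [chiZ_non h2, eta_neg h.ne, eta_non h2]; simp
    rw [this, smul_sub]; abel
  · subst h
    have e1 : chiZ 0 = 1 := by simpa using chiZ_int 0
    have e2 : eta (-0) = -1 := by simpa using eta_int 0
    rw [e1, e2]
    convert (SpL F (LowI 0) v z).zero_mem using 1
    simp [geomS, sub_smul]
  · have h1 := SpL_mono (F := F) (LowT_I h.le) v z (Tmid_gen k v z α)
    have h2 : X F r z ∈ SpL F (LowI α) v z :=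
      mem_SpL 0 (Or.inl ⟨le_rfl, by simpa using h⟩) (by simp)
    have h3 := (SpL F (LowI α) v z).sub_mem h1 ((SpL F (LowI α) v z).smul_mem
      ((k : F) - (k : F)⁻¹) h2)
    rw [eta_neg h.ne']
    convert h3 using 1
    abel

theorem Ne_mem {c : F} {v z : E r} {α : ℝ} (h : ¬ ∃ n : ℤ, 1 ≤ n ∧ α = (2 * n : ℤ)) :
    geomS F r c ((2 : ℝ) • v) (-floorE α / 2) * X F r z ∈ SpL F (LowT α) v z := by
  rw [floorE_half]
  have h1 := Int.floor_le (α / 2)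
  have h2 := Int.lt_floor_add_one (α / 2)
  by_cases h0 : 0 ≤ -⌊α / 2⌋
  · refine geomS_pos _ h0 fun t ht1 ht2 => mem_SpL (-(2 * t)) (Or.inr ⟨?_, by omega⟩) (vec2 _ _ _)
    have : 2 * ((⌊α / 2⌋ : ℝ) + 1) ≤ ((-(2 * t) : ℤ) : ℝ) := by
      exact_mod_cast (by omega : 2 * (⌊α / 2⌋ + 1) ≤ -(2 * t))
    linarith
  · refine geomS_neg _ (by omega) fun t ht1 ht2 =>
      mem_SpL (-(2 * t)) (Or.inl ⟨by omega, ?_⟩) (vec2 _ _ _)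
    have h3 : ((-(2 * t) : ℤ) : ℝ) ≤ 2 * ⌊α / 2⌋ := by
      exact_mod_cast (by omega : -(2 * t) ≤ 2 * ⌊α / 2⌋)
    refine lt_of_le_of_ne (by linarith) fun e => h ⟨-t, by omega, ?_⟩
    rw [← e]; push_cast; ring

theorem Ne_lead {s : F} {v z : E r} {n : ℤ} (h : 1 ≤ n) :
    geomS F r (s * s) ((2 : ℝ) • v) (-floorE ((2 * n : ℤ) : ℝ) / 2) * X F r z
      + s ^ (-(2 * n)) • X F r (z - ((2 * n : ℤ) : ℝ) • v) ∈ SpL F (LowT (2 * n : ℤ)) v z := by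
  rw [floorE_half]
  have e : ⌊((2 * n : ℤ) : ℝ) / 2⌋ = n := by
    rw [show ((2 * n : ℤ) : ℝ) / 2 = n by push_cast; ring, Int.floor_intCast]
  rw [e]
  have := geomS_neg_lead (c := s * s) (v := (2 : ℝ) • v) (z := z) (M := -n)
    (SpL F (LowT (2 * n : ℤ)) v z) (by omega)
    fun t ht1 ht2 => mem_SpL (-(2 * t))
      (Or.inl ⟨by omega, by exact_mod_cast (by omega : -(2 * t) < 2 * n)⟩) (vec2 _ _ _)
  rw [vec2] at this
  convert this using 3
  · rw [← pow_two, ← zpow_natCast, ← zpow_mul]; congr 1; push_cast; ring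
  · congr 2; push_cast; ring_nf

theorem No_mem {c s : F} {v z : E r} {α : ℝ} (h : ¬ ∃ n : ℤ, 0 ≤ n ∧ α = (2 * n + 1 : ℤ)) :
    (s • X F r v) * geomS F r c ((2 : ℝ) • v) ((-floorO α - 1) / 2) * X F r z
      ∈ SpL F (LowT α) v z := by
  rw [floorO_half, mul_right_comm, smul_mul_assoc, X_mul, smul_mul_assoc, mul_comm (X F r (v + z)), add_comm v z]
  refine Submodule.smul_mem _ _ ?_
  have h1 := Int.floor_le ((α + 1) / 2)
  have h2 := Int.lt_floor_add_one ((α + 1) / 2)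
  by_cases h0 : 0 ≤ -⌊(α + 1) / 2⌋
  · refine geomS_pos _ h0 fun t ht1 ht2 => mem_SpL (-(2 * t) - 1) (Or.inr ⟨?_, by omega⟩)
      (vec3 _ _ _)
    have : 2 * ((⌊(α + 1) / 2⌋ : ℝ) + 1) - 1 ≤ ((-(2 * t) - 1 : ℤ) : ℝ) := by
      exact_mod_cast (by omega : 2 * (⌊(α + 1) / 2⌋ + 1) - 1 ≤ -(2 * t) - 1)
    linarith
  · refine geomS_neg _ (by omega) fun t ht1 ht2 =>
      mem_SpL (-(2 * t) - 1) (Or.inl ⟨by omega, ?_⟩) (vec3 _ _ _)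
    have h3 : ((-(2 * t) - 1 : ℤ) : ℝ) ≤ 2 * ⌊(α + 1) / 2⌋ - 1 := by
      exact_mod_cast (by omega : -(2 * t) - 1 ≤ 2 * ⌊(α + 1) / 2⌋ - 1)
    refine lt_of_le_of_ne (by linarith) fun e => h ⟨-t - 1, by omega, ?_⟩
    rw [← e]; push_cast; ring

theorem No_lead {s : F} (hs : s ≠ 0) {v z : E r} {n : ℤ} (h : 0 ≤ n) :
    (s • X F r v) * geomS F r (s * s) ((2 : ℝ) • v) ((-floorO ((2 * n + 1 : ℤ) : ℝ) - 1) / 2)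
        * X F r z
      + s ^ (-(2 * n + 1)) • X F r (z - ((2 * n + 1 : ℤ) : ℝ) • v)
      ∈ SpL F (LowT (2 * n + 1 : ℤ)) v z := by
  rw [floorO_half, mul_right_comm, smul_mul_assoc, X_mul, smul_mul_assoc,
    mul_comm (X F r (v + z)), add_comm v z]
  have e : ⌊(((2 * n + 1 : ℤ) : ℝ) + 1) / 2⌋ = n + 1 := by
    rw [show (((2 * n + 1 : ℤ) : ℝ) + 1) / 2 = (n + 1 : ℤ) by push_cast; ring, Int.floor_intCast]
  rw [e]
  have := geomS_neg_lead (c := s * s) (v := (2 : ℝ) • v) (z := z + v) (M := -(n + 1))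
    (SpL F (LowT (2 * n + 1 : ℤ)) v z) (by omega)
    fun t ht1 ht2 => mem_SpL (-(2 * t) - 1)
      (Or.inl ⟨by omega, by exact_mod_cast (by omega : -(2 * t) - 1 < 2 * n + 1)⟩) (vec3 _ _ _)
  rw [vec3] at this
  have := Submodule.smul_mem _ s this
  rw [smul_add, smul_smul] at this
  convert this using 3
  · rw [← pow_two, ← zpow_natCast, ← zpow_mul, mul_comm s, ← zpow_add_one₀ hs]
    congr 1; push_cast; ring
  · congr 2; push_cast; ring_nf

theorem Teo_alg (κ κ' υ υ' θ : F) (A N M : QA F r) :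
    (κ * θ) • A + (κ - κ') • N + (υ - υ') • M - (κ' * θ) • A
      = (κ - κ') • (N + θ • A) + (υ - υ') • M := by module

theorem Teo_alg2 (κ κ' υ υ' θ : F) (A N M : QA F r) :
    (υ * θ) • A + (κ - κ') • N + (υ - υ') • M - (υ' * θ) • A
      = (κ - κ') • N + (υ - υ') • (M + θ • A) := by module

theorem Teo_gen (κ υ s Θ : Fˣ) (v z : E r) (α : ℝ) (hΘ : ∀ n : ℤ, α = n → Θ = s ^ (-n)) :
    ((κ : F) ^ chiE α * (υ : F) ^ chiO α * (Θ : F)) • X F r (z - α • v)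
      + ((κ : F) - (κ : F)⁻¹) • (geomS F r ((s : F) * s) ((2 : ℝ) • v) (-floorE α / 2) * X F r z)
      + ((υ : F) - (υ : F)⁻¹) • (((s : F) • X F r v) *
          geomS F r ((s : F) * s) ((2 : ℝ) • v) ((-floorO α - 1) / 2) * X F r z)
      - ((κ ^ (-etaE α) * υ ^ (-etaO α) * Θ : Fˣ) : F) • X F r (z - α • v)
      ∈ SpL F (LowT α) v z := by
  have hs : (s : F) ≠ 0 := s.ne_zero
  by_cases he : ∃ n : ℤ, 1 ≤ n ∧ α = (2 * n : ℤ)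
  · obtain ⟨n, h1, rfl⟩ := he
    have ho : ¬ ∃ m : ℤ, 0 ≤ m ∧ ((2 * n : ℤ) : ℝ) = (2 * m + 1 : ℤ) := by
      rintro ⟨m, _, h⟩; have : 2 * n = 2 * m + 1 := by exact_mod_cast h
      omega
    have a1 := Ne_lead (s := (s : F)) (v := v) (z := z) h1
    have a2 := No_mem (c := (s : F) * s) (s := (s : F)) (v := v) (z := z) ho
    have e1 : (κ : F) ^ chiE ((2 * n : ℤ) : ℝ) * (υ : F) ^ chiO ((2 * n : ℤ) : ℝ) * (Θ : F)
        = κ * (s : F) ^ (-(2 * n)) := by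
      rw [hΘ _ rfl, chiE_int, chiO_int, if_pos (Dvd.intro _ rfl), if_pos (Dvd.intro _ rfl)]
      rw [pow_one, pow_zero, mul_one, Units.val_zpow_eq_zpow_val]
    have e2 : ((κ ^ (-etaE ((2 * n : ℤ) : ℝ)) * υ ^ (-etaO ((2 * n : ℤ) : ℝ)) * Θ : Fˣ) : F)
        = (κ : F)⁻¹ * (s : F) ^ (-(2 * n)) := by
      rw [hΘ _ rfl, etaE_int, etaO_int, if_pos (Dvd.intro _ rfl), if_pos (Dvd.intro _ rfl),
        if_pos (by omega)]
      rw [neg_zero, zpow_zero, mul_one, zpow_neg_one, Units.val_mul, Units.val_zpow_eq_zpow_val,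
        Units.val_inv_eq_inv_val]
    rw [e1, e2, Teo_alg]
    exact Submodule.add_mem _ (Submodule.smul_mem _ _ a1) (Submodule.smul_mem _ _ a2)
  by_cases ho : ∃ n : ℤ, 0 ≤ n ∧ α = (2 * n + 1 : ℤ)
  · obtain ⟨n, h1, rfl⟩ := ho
    have hd : ¬ (2 : ℤ) ∣ 2 * n + 1 := by omega
    have a1 := Ne_mem (c := (s : F) * s) (v := v) (z := z) he
    have a2 := No_lead (v := v) (z := z) hs h1
    have e1 : (κ : F) ^ chiE ((2 * n + 1 : ℤ) : ℝ) * (υ : F) ^ chiO ((2 * n + 1 : ℤ) : ℝ) * (Θ : F)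
        = υ * (s : F) ^ (-(2 * n + 1)) := by
      rw [hΘ _ rfl, chiE_int, chiO_int, if_neg hd, if_neg hd]
      rw [pow_one, pow_zero, one_mul, Units.val_zpow_eq_zpow_val]
    have e2 : ((κ ^ (-etaE ((2 * n + 1 : ℤ) : ℝ)) * υ ^ (-etaO ((2 * n + 1 : ℤ) : ℝ)) * Θ : Fˣ) : F)
        = (υ : F)⁻¹ * (s : F) ^ (-(2 * n + 1)) := by
      rw [hΘ _ rfl, etaE_int, etaO_int, if_neg hd, if_neg hd, if_pos (by omega)]
      rw [neg_zero, zpow_zero, one_mul, zpow_neg_one, Units.val_mul, Units.val_zpow_eq_zpow_val,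
        Units.val_inv_eq_inv_val]
    rw [e1, e2, Teo_alg2]
    exact Submodule.add_mem _ (Submodule.smul_mem _ _ a1) (Submodule.smul_mem _ _ a2)
  have a1 := Ne_mem (c := (s : F) * s) (v := v) (z := z) he
  have a2 := No_mem (c := (s : F) * s) (s := (s : F)) (v := v) (z := z) ho
  have : (κ : F) ^ chiE α * (υ : F) ^ chiO α = ((κ ^ (-etaE α) * υ ^ (-etaO α) : Fˣ) : F) := by
    by_cases h : ∃ n : ℤ, α = n
    · obtain ⟨n, rfl⟩ := h
      rw [chiE_int, chiO_int, etaE_int, etaO_int]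
      by_cases hd : (2 : ℤ) ∣ n
      · have : ¬ 2 ≤ n := by
          intro h; obtain ⟨m, rfl⟩ := hd; exact he ⟨m, by omega, rfl⟩
        simp [hd, this]
      · have : ¬ 1 ≤ n := by
          intro h
          exact ho ⟨n / 2, by omega, by rw [show 2 * (n / 2) + 1 = n by omega]⟩
        simp [hd, this]
    · rw [chiE_non h, chiO_non h, etaE_non h, etaO_non h]; simp
  rw [this, Units.val_mul _ Θ, add_assoc, add_sub_cancel_left]
  exact Submodule.add_mem _ (Submodule.smul_mem _ _ a1) (Submodule.smul_mem _ _ a2)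
end ops

/-! ### Part 6: one step of the computation -/

section step
variable {F : Type*} [Field F] {r : ℕ}

theorem epsV_fin (a : Fin r) : epsV r (a + 1) = eV r a := by
  funext m
  simp only [epsV, eV, Nat.add_right_cancel_iff, Fin.ext_iff]

theorem Tmid_X (hr : 2 ≤ r) (qh : Fˣ) (k0 u0 kr ur : F) (k : Fˣ) (t : Fin r → Fˣ) (a b : Fin r)
    (hab : (b : ℕ) = a + 1) (z : E r) :
    Tfull F r qh k0 u0 (k : F) kr ur t (a + 1) (X F r z)
      - ((k ^ (-eta (ip r (abarR r (a + 1)) z)) : Fˣ) : F) • X F r (sbar r (a + 1) z)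
      ∈ SpL F (LowT (ip r (abarR r (a + 1)) z)) (abV r (a + 1)) z := by
  have hj : (a : ℕ) + 1 ≠ r := by have := b.2; omega
  have hj' : (a : ℕ) + 1 ≤ r := by have := b.2; omega
  rw [Tfull, if_neg (by omega), Top, mkOp_X, Tel, if_neg hj, nablaIel, sW_eq hr (by omega) hj',
    epsV_fin, cd_fin, ← hab, epsV_fin, cd_fin, sbar, ← abV_mid a b hab]
  have e : z a - z b = ip r (abarR r (a + 1)) z := by
    rw [abarR_mid a b hab, ip_sub_left, ip_eV, ip_eV]
  rw [e]; simp only [hab]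
  exact Tmid_gen k _ z _

theorem Tinv_X (hr : 2 ≤ r) (qh : Fˣ) (k0 u0 kr ur : F) (k : Fˣ) (t : Fin r → Fˣ) (a b : Fin r)
    (hab : (b : ℕ) = a + 1) (z : E r) :
    TfullInv F r qh k0 u0 (k : F) kr ur t (a + 1) (X F r z)
      - ((k ^ (eta (-ip r (abarR r (a + 1)) z)) : Fˣ) : F) • X F r (sbar r (a + 1) z)
      ∈ SpL F (LowI (ip r (abarR r (a + 1)) z)) (abV r (a + 1)) z := by
  have hj : (a : ℕ) + 1 ≠ r := by have := b.2; omega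
  have hj' : (a : ℕ) + 1 ≤ r := by have := b.2; omega
  rw [TfullInv, LinearMap.sub_apply, LinearMap.smul_apply, Module.End.one_apply, kpar,
    if_neg (by omega), if_neg hj,
    Tfull, if_neg (by omega), Top, mkOp_X, Tel, if_neg hj, nablaIel, sW_eq hr (by omega) hj',
    epsV_fin, cd_fin, ← hab, epsV_fin, cd_fin, sbar, ← abV_mid a b hab]
  have e : z a - z b = ip r (abarR r (a + 1)) z := by
    rw [abarR_mid a b hab, ip_sub_left, ip_eV, ip_eV]
  rw [e]; simp only [hab]
  exact Tinv_gen k _ z _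

theorem Tlast_X (hr : 2 ≤ r) (qh : Fˣ) (k0 u0 k : F) (kr ur : Fˣ) (t : Fin r → Fˣ) (z : E r) :
    Tfull F r qh k0 u0 k (kr : F) (ur : F) t r (X F r z)
      - ((kr ^ (-etaE (ip r (abarR r r) z)) * ur ^ (-etaO (ip r (abarR r r) z)) : Fˣ) : F)
        • X F r (sbar r r z)
      ∈ SpL F (LowT (ip r (abarR r r) z)) (abV r r) z := by
  let a : Fin r := ⟨r - 1, by omega⟩
  have ha : (a : ℕ) + 1 = r := by simp [a]; omega
  have e1 : epsV r r = abV r r := by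
    rw [abV_last (by omega)]
    have := epsV_fin a; rw [ha] at this; exact this
  have e2 : 2 * cd r z r = ip r (abarR r r) z := by
    rw [abarR_last (by omega), ip_smul_left, ip_eV]
    have := cd_fin z a; rw [ha] at this; rw [this]
  rw [Tfull, if_neg (by omega), Top, mkOp_X, Tel, if_pos rfl, nablaReEl, nablaRoEl,
    sW_eq hr (by omega) le_rfl, e1, e2, sbar]
  have := Teo_gen (F := F) kr ur 1 1 (abV r r) z (ip r (abarR r r) z) (by simp)
  simpa using this

theorem T0_X (hr : 2 ≤ r) {O : Set (E r)} (hO : IsOrbit r O) {qh : Fˣ} {t : Fin r → Fˣ}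
    (ht : t ∈ TOset F r qh O) (k kr ur : F) (k0 u0 : Fˣ) (z : E r) (hz : z ∈ O) :
    Tfull F r qh (k0 : F) (u0 : F) k kr ur t 0 (X F r z)
      - ((k0 ^ (-etaE (ip r (abarR r 0) z)) * u0 ^ (-etaO (ip r (abarR r 0) z))
          * Th F r qh t z ⟨0, by omega⟩ : Fˣ) : F) • X F r (sbar r 0 z)
      ∈ SpL F (LowT (ip r (abarR r 0) z)) (abV r 0) z := by
  let a : Fin r := ⟨0, by omega⟩
  have e0 : cd r z 1 = z a := cd_fin z a
  have e1 : (-1 : ℝ) • epsV r 1 = abV r 0 := by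
    rw [abV_zero (by omega)]; rw [← epsV_fin a]
  have e1' : (-2 : ℝ) • epsV r 1 = (2 : ℝ) • abV r 0 := by
    rw [← e1, smul_smul]; norm_num
  have e2 : -2 * cd r z 1 = ip r (abarR r 0) z := by
    rw [abarR_zero (by omega), ip_smul_left, ip_eV, e0]
  have e3 : 2 * cd r z 1 = - ip r (abarR r 0) z := by rw [← e2]; ring
  have e4 : tcU F r (torusAct F r qh (gfun r z) t) 1 = Th F r qh t z a := tcU_fin _ a
  have c1 : ∀ x : ℝ, chiE (-x) = chiE x := by
    intro x
    have : (∃ n : ℤ, -x = 2 * n) ↔ ∃ n : ℤ, x = 2 * n :=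
      ⟨fun ⟨n, h⟩ => ⟨-n, by push_cast; linarith⟩, fun ⟨n, h⟩ => ⟨-n, by push_cast; linarith⟩⟩
    simp only [chiE, this]
  have c2 : ∀ x : ℝ, chiO (-x) = chiO x := by
    intro x
    have : (∃ n : ℤ, -x = 2 * n + 1) ↔ ∃ n : ℤ, x = 2 * n + 1 :=
      ⟨fun ⟨n, h⟩ => ⟨-n - 1, by push_cast; linarith⟩,
        fun ⟨n, h⟩ => ⟨-n - 1, by push_cast; linarith⟩⟩
    simp only [chiO, this]
  rw [Tfull, if_pos rfl, T0op, mkOp_X, T0el, nabla0eEl, nabla0oEl, sEps1_eq hr, e1, e1', e2, e3, e4,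
    c1, c2, sbar]
  refine Teo_gen (F := F) k0 u0 qh (Th F r qh t z a) (abV r 0) z (ip r (abarR r 0) z) ?_
  intro n hn
  apply Th_half hr hO ht hz
  rw [← e0, e3, hn]; push_cast; ring

/-- the span of the strictly lower terms -/
def LS (F : Type*) [Field F] {r : ℕ} (c : E r) (w : E r → E r) (y : E r) : Submodule F (QA F r) :=
  Submodule.span F {p | ∃ y', Plt c y' y ∧ p = X F r (w y')}

theorem refl_shift (hr : 2 ≤ r) {w : E r → E r} (hw : SP w) {j : ℕ} (hj : j ≤ r) {bv : E r}
    (hb : w bv = abarR r j) (y : E r) (m : ℤ) :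
    w y - (m : ℝ) • abV r j = sbar r j (w (srt bv (-m) y)) := by
  have e1 : ip r bv bv = ip r (abarR r j) (abarR r j) := by rw [← hb, hw.ip]
  have hs := SP.sbar hr hj
  rw [srt, hw.sub, hw.smul, hw.smul, hb, e1, coroot_abar hr hj, hs.sub, hs.smul, sbar_abV hr hj,
    sbar, aff, ← hb, hw.ip]
  push_cast
  module

theorem step_gen (hr : 2 ≤ r) {c y : E r} {w : E r → E r} (hw : SP w) {j : ℕ} (hj : j ≤ r)
    {bv : E r} (hb : w bv = abarR r j) (low : ℝ → ℤ → Prop)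
    (hlow : ∀ y' m, low (ip r bv y') m → Plt c (srt bv (-m) y') y')
    (T : Module.End F (QA F r)) (L : E r → Fˣ)
    (hT : ∀ y', (y' = y ∨ Plt c y' y) → T (X F r (w y')) - ((L (w y') : Fˣ) : F) • X F r (sbar r j (w y'))
      ∈ SpL F (low (ip r (abarR r j) (w y'))) (abV r j) (w y'))
    (C : Fˣ) (f : QA F r) (hf : f - (C : F) • X F r (w y) ∈ LS F c w y) :
    T f - ((C * L (w y) : Fˣ) : F) • X F r (sbar r j (w y)) ∈ LS F c (fun z => sbar r j (w z)) y := by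
  have key : ∀ y', SpL F (low (ip r (abarR r j) (w y'))) (abV r j) (w y')
      ≤ LS F c (fun z => sbar r j (w z)) y' := by
    intro y'
    refine Submodule.span_le.2 ?_
    rintro p ⟨m, hm, rfl⟩
    rw [← hb, hw.ip] at hm
    rw [refl_shift hr hw hj hb]
    exact Submodule.subset_span ⟨_, hlow _ _ hm, rfl⟩
  have mono : ∀ y', Plt c y' y → LS F c (fun z => sbar r j (w z)) y'
      ≤ LS F c (fun z => sbar r j (w z)) y := by
    intro y' h
    apply Submodule.span_mono
    rintro p ⟨y'', h', rfl⟩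
    exact ⟨y'', h'.trans h, rfl⟩
  have h1 : T (f - (C : F) • X F r (w y)) ∈ LS F c (fun z => sbar r j (w z)) y := by
    have : LS F c w y ≤ (LS F c (fun z => sbar r j (w z)) y).comap T := by
      refine Submodule.span_le.2 ?_
      rintro p ⟨y', h', rfl⟩
      show T (X F r (w y')) ∈ LS F c (fun z => sbar r j (w z)) y
      have h2 := mono y' h' (key y' (hT y' (Or.inr h')))
      have h3 : X F r (sbar r j (w y')) ∈ LS F c (fun z => sbar r j (w z)) y :=
        Submodule.subset_span ⟨y', h', rfl⟩
      have := Submodule.add_mem _ h2 (Submodule.smul_mem _ ((L (w y') : Fˣ) : F) h3)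
      simpa using this
    exact this hf
  have h2 := Submodule.smul_mem _ (C : F) (key y (hT y (Or.inl rfl)))
  convert Submodule.add_mem _ h1 h2 using 1
  rw [map_sub, map_smul, smul_sub, smul_smul, Units.val_mul]
  abel

theorem srt_neg (v : E r) (n : ℤ) (y : E r) : srt (-v) (-n) y = srt v n y := by
  have e1 : ip r (-v) (-v) = ip r v v := by simp [ip]
  have e2 : aff (-v) (-n) y = - aff v n y := by
    simp only [aff, ip_neg_left]; push_cast; ring
  rw [srt, srt, e1, e2]
  module

theorem lowT_plt (hr : 2 ≤ r) {c : E r} (hc : c ∈ CplusCl r) {bv : E r} (hb : IsRt bv)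
    (h0 : ∀ x ∈ CplusCl r, 0 ≤ ip r bv x ∧ ip r bv x ≤ 1) (y' : E r) (m : ℤ)
    (hm : LowT (ip r bv y') m) : Plt c (srt bv (-m) y') y' := by
  rcases hm with ⟨h1, h2⟩ | ⟨h1, h2⟩
  · have := Plt.refl_lower hr hc (y := y') hb.neg m (fun x hx => by
      have h1' : (1 : ℝ) ≤ m := by exact_mod_cast h1
      have := h0 x hx
      rw [aff, ip_neg_left]; linarith) (by rw [aff, ip_neg_left]; linarith)
    rw [← srt_neg, neg_neg]; exact this
  · refine Plt.refl_lower hr hc (y := y') hb (-m) (fun x hx => ?_) ?_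
    · have h1' : (m : ℝ) ≤ 0 := by exact_mod_cast h2
      have := h0 x hx
      rw [aff]; push_cast; linarith
    · rw [aff]; push_cast; linarith

theorem lowI_plt (hr : 2 ≤ r) {c : E r} (hc : c ∈ CplusCl r) {bv : E r} (hb : IsRt bv)
    (h0 : ∀ x ∈ CplusCl r, -1 ≤ ip r bv x ∧ ip r bv x ≤ 0) (y' : E r) (m : ℤ)
    (hm : LowI (ip r bv y') m) : Plt c (srt bv (-m) y') y' := by
  rcases hm with ⟨h1, h2⟩ | ⟨h1, h2⟩
  · have := Plt.refl_lower hr hc (y := y') hb.neg m (fun x hx => by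
      have h1' : (0 : ℝ) ≤ m := by exact_mod_cast h1
      have := h0 x hx
      rw [aff, ip_neg_left]; linarith) (by rw [aff, ip_neg_left]; linarith)
    rw [← srt_neg, neg_neg]; exact this
  · refine Plt.refl_lower hr hc (y := y') hb (-m) (fun x hx => ?_) ?_
    · have h1' : (m : ℝ) ≤ -1 := by exact_mod_cast (by omega : m ≤ -1)
      have := h0 x hx
      rw [aff]; push_cast; linarith
    · rw [aff]; push_cast; linarith

end step

/-! ### Part 7: the stages of the computation -/

section stages
variable {F : Type*} [Field F] {r : ℕ}

theorem sbar_mid (hr : 2 ≤ r) (a b : Fin r) (h : (b : ℕ) = a + 1) (m : Fin r) :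
    sbar r (a + 1) (eV r m) = eV r (Equiv.swap a b m) := by
  have hj : (a : ℕ) + 1 ≤ r := by have := b.2; omega
  have e := genF_eq_sbar hr hj (eV r m)
  rw [nz, if_neg (by omega)] at e
  have e' : sbar r (a + 1) (eV r m) = genF r (a + 1) (eV r m) := by rw [e]; simp
  rw [e']
  funext n
  rw [genF_mid_apply a b h]
  simp only [eV]
  have : Equiv.swap a b n = m ↔ n = Equiv.swap a b m :=
    ⟨fun h => by rw [← h, Equiv.swap_apply_self], fun h => by rw [h, Equiv.swap_apply_self]⟩
  simp only [this]

theorem sbar_zero_eV (hr : 2 ≤ r) (m : Fin r) :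
    sbar r 0 (eV r m) = if (m : ℕ) = 0 then -eV r m else eV r m := by
  have h : 0 < r := by omega
  rw [sbar, abarR_zero h, abV_zero h, ip_smul_left, ip_eV]
  split_ifs with hm
  · have : m = ⟨0, h⟩ := Fin.ext hm
    subst this
    simp only [eV, if_true]; module
  · have : (⟨0, h⟩ : Fin r) ≠ m := fun h' => hm (by rw [← h'])
    have e : eV r m ⟨0, h⟩ = 0 := by simp only [eV]; rw [if_neg this]
    rw [e]; simp

theorem sbar_last_eV (hr : 2 ≤ r) (m : Fin r) :
    sbar r r (eV r m) = if (m : ℕ) + 1 = r then -eV r m else eV r m := by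
  have h : r - 1 < r := by omega
  rw [sbar, abarR_last h, abV_last h, ip_smul_left, ip_eV]
  split_ifs with hm
  · have : m = ⟨r - 1, h⟩ := Fin.ext (by simp; omega)
    subst this
    simp only [eV, if_true]; module
  · have : (⟨r - 1, h⟩ : Fin r) ≠ m := fun h' => hm (by rw [← h']; simp; omega)
    have e : eV r m ⟨r - 1, h⟩ = 0 := by simp only [eV]; rw [if_neg this]
    rw [e]; simp

/-- the index of `b` after removing `i` -/
def rho (i b : ℕ) : ℕ := if b < i then b else b - 1

/-- the index of `b` after moving `i` to position `p` -/
def shp (i p b : ℕ) : ℕ := if rho i b < p then rho i b else rho i b + 1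

/-- `w` moves the `i`-th basis vector to position `p` with sign `σ` -/
def Stage (i : Fin r) (p : ℕ) (σ : ℝ) (w : E r → E r) : Prop :=
  SP w ∧ (∀ q : Fin r, (q : ℕ) = p → w (eV r i) = σ • eV r q) ∧
    ∀ b q : Fin r, b ≠ i → (q : ℕ) = shp i p b → w (eV r b) = eV r q

theorem Stage.start (i : Fin r) : Stage i i 1 (fun y => y) := by
  refine ⟨SP.id, fun q hq => ?_, fun b q hb hq => ?_⟩
  · rw [Fin.ext hq, one_smul]
  · have hb' : (b : ℕ) ≠ i := fun h => hb (Fin.ext h)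
    have : (q : ℕ) = b := by rw [hq, shp, rho]; split_ifs <;> omega
    rw [Fin.ext this]

theorem Stage.eq_self {i : Fin r} {w : E r → E r} (h : Stage i i 1 w) (y : E r) : w y = y := by
  have e : ∀ b, w (eV r b) = eV r b := by
    intro b
    by_cases hb : b = i
    · subst hb; rw [h.2.1 b rfl, one_smul]
    · have hb' : (b : ℕ) ≠ i := fun h => hb (Fin.ext h)
      refine h.2.2 b b hb ?_
      rw [shp, rho]; split_ifs <;> omega
  funext m
  rw [← ip_eV m (w y), ← e m, h.1.ip, ip_eV]

theorem Stage.up (hr : 2 ≤ r) {i : Fin r} {σ : ℝ} {w : E r → E r} (a b : Fin r)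
    (hab : (b : ℕ) = a + 1) (h : Stage i a σ w) :
    Stage i (a + 1) σ (fun z => sbar r (a + 1) (w z)) := by
  have hj : (a : ℕ) + 1 ≤ r := by have := b.2; omega
  have hs := SP.sbar hr hj
  refine ⟨hs.comp h.1, fun q hq => ?_, fun m q hm hq => ?_⟩
  · show sbar r (a + 1) (w (eV r i)) = _
    rw [h.2.1 a rfl, hs.smul, sbar_mid hr a b hab, Equiv.swap_apply_left,
      Fin.ext (hq.trans hab.symm)]
  · show sbar r (a + 1) (w (eV r m)) = _
    have hm' : (m : ℕ) ≠ i := fun h => hm (Fin.ext h)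
    by_cases hq' : q = a
    · subst hq'
      rw [h.2.2 m b hm (by rw [hab]; revert hq; simp only [shp]; split_ifs <;> omega),
        sbar_mid hr q b hab, Equiv.swap_apply_right]
    · have hq'' : (q : ℕ) ≠ a := fun h => hq' (Fin.ext h)
      have hqb : q ≠ b := by
        rintro rfl; revert hq; simp only [shp]; split_ifs <;> omega
      rw [h.2.2 m q hm (by revert hq; simp only [shp]; split_ifs <;> omega),
        sbar_mid hr a b hab, Equiv.swap_apply_of_ne_of_ne hq' hqb]

theorem Stage.down (hr : 2 ≤ r) {i : Fin r} {σ : ℝ} {w : E r → E r} (a b : Fin r)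
    (hab : (b : ℕ) = a + 1) (h : Stage i (a + 1) σ w) :
    Stage i a σ (fun z => sbar r (a + 1) (w z)) := by
  have hj : (a : ℕ) + 1 ≤ r := by have := b.2; omega
  have hs := SP.sbar hr hj
  refine ⟨hs.comp h.1, fun q hq => ?_, fun m q hm hq => ?_⟩
  · show sbar r (a + 1) (w (eV r i)) = _
    rw [h.2.1 b hab, hs.smul, sbar_mid hr a b hab, Equiv.swap_apply_right, Fin.ext hq]
  · show sbar r (a + 1) (w (eV r m)) = _
    have hm' : (m : ℕ) ≠ i := fun h => hm (Fin.ext h)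
    by_cases hq' : q = b
    · subst hq'
      rw [h.2.2 m a hm (by revert hq; simp only [shp]; split_ifs <;> omega),
        sbar_mid hr a q hab, Equiv.swap_apply_left]
    · have hq'' : (q : ℕ) ≠ b := fun h => hq' (Fin.ext h)
      have hqb : q ≠ a := by
        rintro rfl; revert hq; simp only [shp]; split_ifs <;> omega
      rw [h.2.2 m q hm (by revert hq; simp only [shp]; split_ifs <;> omega),
        sbar_mid hr a b hab, Equiv.swap_apply_of_ne_of_ne hqb hq']

theorem Stage.last (hr : 2 ≤ r) {i : Fin r} {σ : ℝ} {w : E r → E r} (h : Stage i (r - 1) σ w) :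
    Stage i (r - 1) (-σ) (fun z => sbar r r (w z)) := by
  have hs := SP.sbar hr (le_refl r)
  refine ⟨hs.comp h.1, fun q hq => ?_, fun m q hm hq => ?_⟩
  · show sbar r r (w (eV r i)) = _
    rw [h.2.1 q hq, hs.smul, sbar_last_eV hr, if_pos (by omega)]; module
  · show sbar r r (w (eV r m)) = _
    have hm' : (m : ℕ) ≠ i := fun h => hm (Fin.ext h)
    have := m.2
    have := i.2
    rw [h.2.2 m q hm hq, sbar_last_eV hr,
      if_neg (by revert hq; simp only [shp, rho]; split_ifs <;> omega)]

theorem Stage.first (hr : 2 ≤ r) {i : Fin r} {σ : ℝ} {w : E r → E r} (h : Stage i 0 σ w) :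
    Stage i 0 (-σ) (fun z => sbar r 0 (w z)) := by
  have hs := SP.sbar hr (Nat.zero_le r)
  refine ⟨hs.comp h.1, fun q hq => ?_, fun m q hm hq => ?_⟩
  · show sbar r 0 (w (eV r i)) = _
    rw [h.2.1 q hq, hs.smul, sbar_zero_eV hr, if_pos (by omega)]; module
  · show sbar r 0 (w (eV r m)) = _
    rw [h.2.2 m q hm hq, sbar_zero_eV hr,
      if_neg (by revert hq; simp only [shp, rho]; split_ifs <;> omega)]

/-- the state of the computation -/
def St (O : Set (E r)) (y : E r) (i : Fin r) (p : ℕ) (σ : ℝ) (Q : Prop) (C : Fˣ)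
    (f : QA F r) : Prop :=
  ∃ w, Stage i p σ w ∧ (Q → ∀ y' ∈ O, w y' ∈ O) ∧
    f - (C : F) • X F r (w y) ∈ LS F (cpt r O) w y

theorem sbar_orbit (hr : 2 ≤ r) {O : Set (E r)} (hO : IsOrbit r O) {j : ℕ} (h1 : 1 ≤ j)
    (hj : j ≤ r) {z : E r} (hz : z ∈ O) : sbar r j z ∈ O := by
  have e := genF_eq_sbar hr hj z
  rw [nz, if_neg (by omega)] at e
  have e' : sbar r j z = genF r j z := by rw [e]; simp
  rw [e']
  exact orbit_genF hO hz [j] (by simpa using hj)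

theorem isRt_sub (a b : Fin r) (h : a ≠ b) : IsRt (eV r a - eV r b) :=
  ⟨a, b, 1, -1, Or.inl rfl, Or.inr rfl, Or.inl h, by push_cast; module⟩

theorem isRt_add (a b : Fin r) : IsRt (eV r a + eV r b) :=
  ⟨a, b, 1, 1, Or.inl rfl, Or.inl rfl, Or.inr rfl, by push_cast; module⟩

theorem isRt_two (a : Fin r) : IsRt ((2 : ℝ) • eV r a) := by
  have := isRt_add a a
  rwa [← two_smul ℝ] at this

variable {O : Set (E r)} {qh k0 u0 k kr ur : Fˣ} {t : Fin r → Fˣ} {y : E r} {i : Fin r}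
  {Q : Prop} {C : Fˣ} {f : QA F r}

theorem St.up (hr : 2 ≤ r) (hO : IsOrbit r O) (a b : Fin r) (hab : (b : ℕ) = a + 1) (hia : i ≤ a)
    (h : St O y i a 1 Q C f) :
    St O y i (a + 1) 1 Q (C * k ^ (-eta (y i - y b)))
      (Tfull F r qh (k0 : F) (u0 : F) (k : F) (kr : F) (ur : F) t (a + 1) f) := by
  obtain ⟨w, hw, hQ, hf⟩ := h
  have hia' : (i : ℕ) ≤ a := hia
  have hj : (a : ℕ) + 1 ≤ r := by have := b.2; omega
  have hib : i < b := Fin.lt_def.2 (by omega)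
  have hb : w (eV r i - eV r b) = abarR r (a + 1) := by
    rw [hw.1.sub, hw.2.1 a rfl, one_smul, abarR_mid a b hab,
      hw.2.2 b b hib.ne' (by simp only [shp, rho]; split_ifs <;> omega)]
  refine ⟨_, hw.up hr a b hab, fun q z hz => sbar_orbit hr hO (by omega) hj (hQ q z hz), ?_⟩
  have := step_gen hr hw.1 hj hb LowT
    (lowT_plt hr (cpt_spec hr hO).2 (isRt_sub i b hib.ne) (fun x hx => by
      rw [ip_sub_left, ip_eV, ip_eV]
      have h1 := hx.1 i b hib.le
      have h2 := hx.2 i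
      have h3 := hx.2 b
      constructor <;> linarith))
    (Tfull F r qh (k0 : F) (u0 : F) (k : F) (kr : F) (ur : F) t (a + 1))
    (fun z => k ^ (-eta (ip r (abarR r (a + 1)) z)))
    (fun y' _ => Tmid_X hr qh _ _ _ _ k t a b hab (w y')) C f hf
  have e : ip r (abarR r (a + 1)) (w y) = y i - y b := by
    rw [← hb, hw.1.ip, ip_sub_left, ip_eV, ip_eV]
  rwa [e] at this

theorem St.down (hr : 2 ≤ r) (hO : IsOrbit r O) (a b m : Fin r) (hab : (b : ℕ) = a + 1)
    (hm : m ≠ i) (hma : rho i m = a)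
    (h : St O y i (a + 1) (-1) Q C f) :
    St O y i a (-1) Q (C * k ^ (-eta (y m + y i)))
      (Tfull F r qh (k0 : F) (u0 : F) (k : F) (kr : F) (ur : F) t (a + 1) f) := by
  obtain ⟨w, hw, hQ, hf⟩ := h
  have hj : (a : ℕ) + 1 ≤ r := by have := b.2; omega
  have hb : w (eV r m + eV r i) = abarR r (a + 1) := by
    rw [hw.1.add, hw.2.1 b hab, abarR_mid a b hab,
      hw.2.2 m a hm (by simp only [shp]; split_ifs <;> omega)]
    module
  refine ⟨_, hw.down hr a b hab, fun q z hz => sbar_orbit hr hO (by omega) hj (hQ q z hz), ?_⟩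
  have := step_gen hr hw.1 hj hb LowT
    (lowT_plt hr (cpt_spec hr hO).2 (isRt_add m i) (fun x hx => by
      rw [ip_add_left, ip_eV, ip_eV]
      have h2 := hx.2 i
      have h3 := hx.2 m
      constructor <;> linarith))
    (Tfull F r qh (k0 : F) (u0 : F) (k : F) (kr : F) (ur : F) t (a + 1))
    (fun z => k ^ (-eta (ip r (abarR r (a + 1)) z)))
    (fun y' _ => Tmid_X hr qh _ _ _ _ k t a b hab (w y')) C f hf
  have e : ip r (abarR r (a + 1)) (w y) = y m + y i := by
    rw [← hb, hw.1.ip, ip_add_left, ip_eV, ip_eV]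
  rwa [e] at this

theorem St.inv (hr : 2 ≤ r) (hO : IsOrbit r O) (a b : Fin r) (hab : (b : ℕ) = a + 1) (hia : a < i)
    (h : St O y i a 1 Q C f) :
    St O y i (a + 1) 1 Q (C * k ^ (eta (y a - y i)))
      (TfullInv F r qh (k0 : F) (u0 : F) (k : F) (kr : F) (ur : F) t (a + 1) f) := by
  obtain ⟨w, hw, hQ, hf⟩ := h
  have hia' : (a : ℕ) < i := hia
  have hj : (a : ℕ) + 1 ≤ r := by have := b.2; omega
  have hb : w (eV r i - eV r a) = abarR r (a + 1) := by
    rw [hw.1.sub, hw.2.1 a rfl, one_smul, abarR_mid a b hab,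
      hw.2.2 a b hia.ne (by simp only [shp, rho]; split_ifs <;> omega)]
  refine ⟨_, hw.up hr a b hab, fun q z hz => sbar_orbit hr hO (by omega) hj (hQ q z hz), ?_⟩
  have := step_gen hr hw.1 hj hb LowI
    (lowI_plt hr (cpt_spec hr hO).2 (isRt_sub i a hia.ne') (fun x hx => by
      rw [ip_sub_left, ip_eV, ip_eV]
      have h1 := hx.1 a i hia.le
      have h2 := hx.2 i
      have h3 := hx.2 a
      constructor <;> linarith))
    (TfullInv F r qh (k0 : F) (u0 : F) (k : F) (kr : F) (ur : F) t (a + 1))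
    (fun z => k ^ (eta (-ip r (abarR r (a + 1)) z)))
    (fun y' _ => Tinv_X hr qh _ _ _ _ k t a b hab (w y')) C f hf
  have e : -ip r (abarR r (a + 1)) (w y) = y a - y i := by
    rw [← hb, hw.1.ip, ip_sub_left, ip_eV, ip_eV]; ring
  rwa [e] at this

theorem St.last (hr : 2 ≤ r) (hO : IsOrbit r O) (h : St O y i (r - 1) 1 Q C f) :
    St O y i (r - 1) (-1) Q (C * (kr ^ (-etaE (2 * y i)) * ur ^ (-etaO (2 * y i))))
      (Tfull F r qh (k0 : F) (u0 : F) (k : F) (kr : F) (ur : F) t r f) := by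
  obtain ⟨w, hw, hQ, hf⟩ := h
  have hb : w ((2 : ℝ) • eV r i) = abarR r r := by
    rw [hw.1.smul, hw.2.1 ⟨r - 1, by omega⟩ rfl, one_smul, abarR_last]
  refine ⟨_, hw.last hr, fun q z hz => sbar_orbit hr hO (by omega) le_rfl (hQ q z hz), ?_⟩
  have := step_gen hr hw.1 le_rfl hb LowT
    (lowT_plt hr (cpt_spec hr hO).2 (isRt_two i) (fun x hx => by
      rw [ip_smul_left, ip_eV]
      have h2 := hx.2 i
      constructor <;> linarith))
    (Tfull F r qh (k0 : F) (u0 : F) (k : F) (kr : F) (ur : F) t r)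
    (fun z => kr ^ (-etaE (ip r (abarR r r) z)) * ur ^ (-etaO (ip r (abarR r r) z)))
    (fun y' _ => Tlast_X hr qh _ _ _ kr ur t (w y')) C f hf
  have e : ip r (abarR r r) (w y) = 2 * y i := by
    rw [← hb, hw.1.ip, ip_smul_left, ip_eV]
  rwa [e] at this

theorem St.first (hr : 2 ≤ r) (hO : IsOrbit r O) (ht : t ∈ TOset F r qh O) (hy : y ∈ O)
    (h : St O y i 0 (-1) True C f) :
    St O y i 0 1 False (C * (k0 ^ (-etaE (2 * y i)) * u0 ^ (-etaO (2 * y i))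
        * (Th F r qh t y i)⁻¹))
      (Tfull F r qh (k0 : F) (u0 : F) (k : F) (kr : F) (ur : F) t 0 f) := by
  obtain ⟨w, hw, hQ, hf⟩ := h
  have hb : w ((2 : ℝ) • eV r i) = abarR r 0 := by
    rw [hw.1.smul, hw.2.1 ⟨0, by omega⟩ rfl, abarR_zero (by omega)]; module
  have h1 := hw.first hr
  rw [neg_neg] at h1
  refine ⟨_, h1, fun q => q.elim, ?_⟩
  have := step_gen hr hw.1 (Nat.zero_le r) hb LowT
    (lowT_plt hr (cpt_spec hr hO).2 (isRt_two i) (fun x hx => by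
      rw [ip_smul_left, ip_eV]
      have h2 := hx.2 i
      constructor <;> linarith))
    (Tfull F r qh (k0 : F) (u0 : F) (k : F) (kr : F) (ur : F) t 0)
    (fun z => k0 ^ (-etaE (ip r (abarR r 0) z)) * u0 ^ (-etaO (ip r (abarR r 0) z))
      * Th F r qh t z ⟨0, by omega⟩)
    (fun y' hy' => T0_X hr hO ht _ _ _ k0 u0 (w y') (hQ trivial y' (by
      rcases hy' with rfl | hy'
      · exact hy
      · exact (Plt.qlt hr hO hy hy').1))) C f hf
  have e : ip r (abarR r 0) (w y) = 2 * y i := by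
    rw [← hb, hw.1.ip, ip_smul_left, ip_eV]
  have e2 : Th F r qh t (w y) ⟨0, by omega⟩ = (Th F r qh t y i)⁻¹ := by
    apply Th_inv hr hO ht hy (hQ trivial y hy)
    rw [← ip_eV i y, ← hw.1.ip, hw.2.1 ⟨0, by omega⟩ rfl, ip_smul_left, ip_eV]; ring
  rwa [e, e2] at this

theorem prod_ins (P P' : Fin r → Prop) [DecidablePred P] [DecidablePred P'] (g : Fin r → Fˣ) (b0 : Fin r)
    (h : ∀ b, P' b ↔ (P b ∨ b = b0)) (hn : ¬ P b0) :
    (∏ b, if P' b then g b else 1) = (∏ b, if P b then g b else 1) * g b0 := by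
  have : g b0 = ∏ b, if b = b0 then g b else 1 := by simp
  rw [this, ← Finset.prod_mul_distrib]
  apply Finset.prod_congr rfl
  intro b _
  by_cases hb : b = b0
  · subst hb; simp [h, hn]
  · simp [h, hb]

theorem up_chain (hr : 2 ≤ r) (hO : IsOrbit r O) (h0 : St O y i i 1 Q C f) (n : ℕ) :
    (i : ℕ) + n + 1 ≤ r →
    St O y i (i + n) 1 Q
      (C * ∏ b : Fin r, if (i : ℕ) < b ∧ (b : ℕ) ≤ i + n then k ^ (-eta (y i - y b)) else 1)
      ((((List.range n).map fun m => (i : ℕ) + n - m).map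
        (Tfull F r qh (k0 : F) (u0 : F) (k : F) (kr : F) (ur : F) t)).prod f) := by
  induction n with
  | zero =>
    intro _
    have : (∏ b : Fin r, if (i : ℕ) < b ∧ (b : ℕ) ≤ i + 0 then k ^ (-eta (y i - y b)) else 1)
        = 1 := Finset.prod_eq_one fun b _ => if_neg (by omega)
    rw [this]; simpa using h0
  | succ n ih =>
    intro hn
    have h1 := ih (by omega)
    have h2 := St.up (qh := qh) (k0 := k0) (u0 := u0) (k := k) (kr := kr) (ur := ur) (t := t)
      hr hO (⟨i + n, by omega⟩ : Fin r) ⟨i + n + 1, by omega⟩ rfl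
      (Fin.le_def.2 (by simp)) h1
    rw [mul_assoc, ← prod_ins (fun b : Fin r => (i : ℕ) < b ∧ (b : ℕ) ≤ i + n)
      (fun b : Fin r => (i : ℕ) < b ∧ (b : ℕ) ≤ i + (n + 1)) (fun b => k ^ (-eta (y i - y b))) _
      (fun b => by rw [Fin.ext_iff]; dsimp only; omega) (by dsimp only; omega)] at h2
    have e : (List.range (n + 1)).map (fun m => (i : ℕ) + (n + 1) - m)
        = (i + n + 1) :: (List.range n).map fun m => (i : ℕ) + n - m := by
      rw [List.range_succ_eq_map, List.map_cons, List.map_map]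
      congr 1
      apply List.map_congr_left
      intro m _
      simp only [Function.comp, Nat.succ_eq_add_one]; omega
    rw [e, List.map_cons, List.prod_cons]
    exact h2

theorem down_chain (hr : 2 ≤ r) (hO : IsOrbit r O) (n : ℕ) : n + 1 ≤ r →
    ∀ (C : Fˣ) (f : QA F r), St O y i n (-1) Q C f →
    St O y i 0 (-1) Q
      (C * ∏ b : Fin r, if b ≠ i ∧ rho i b < n then k ^ (-eta (y b + y i)) else 1)
      ((((List.range n).map (· + 1)).map
        (Tfull F r qh (k0 : F) (u0 : F) (k : F) (kr : F) (ur : F) t)).prod f) := by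
  induction n with
  | zero => intro _ C f h; simpa using h
  | succ n ih =>
    intro hn C f h
    obtain ⟨m, hm, hm'⟩ : ∃ m : Fin r, m ≠ i ∧ rho i m = n := by
      by_cases hni : n < (i : ℕ)
      · refine ⟨⟨n, by omega⟩, fun h => ?_, by simp [rho, hni]⟩
        rw [← h] at hni; simp at hni
      · refine ⟨⟨n + 1, by omega⟩, fun h => ?_, ?_⟩
        · rw [← h] at hni; simp at hni
        · simp only [rho]; rw [if_neg (by omega)]; omega
    have h2 := St.down (qh := qh) (k0 := k0) (u0 := u0) (k := k) (kr := kr) (ur := ur) (t := t)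
      hr hO (⟨n, by omega⟩ : Fin r) ⟨n + 1, by omega⟩ m rfl hm hm' h
    have h3 := ih (by omega) _ _ h2
    have hmi : (m : ℕ) ≠ i := fun h => hm (Fin.ext h)
    rw [mul_assoc, mul_comm (k ^ _), ← prod_ins (fun b : Fin r => b ≠ i ∧ rho i b < n)
      (fun b : Fin r => b ≠ i ∧ rho i b < n + 1) (fun b => k ^ (-eta (y b + y i))) m
      (fun b => by
        rw [Ne, Fin.ext_iff, Fin.ext_iff]; revert hm'; simp only [rho]; split_ifs <;> omega)
      (by rw [hm']; simp)] at h3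
    rw [List.range_succ, List.map_append, List.map_append, List.prod_append]
    simpa using h3

theorem inv_chain (hr : 2 ≤ r) (hO : IsOrbit r O) (h0 : St O y i 0 1 Q C f) (n : ℕ) :
    n ≤ (i : ℕ) →
    St O y i n 1 Q
      (C * ∏ b : Fin r, if (b : ℕ) < n then k ^ (eta (y b - y i)) else 1)
      ((((List.range n).map (· + 1)).reverse.map
        (TfullInv F r qh (k0 : F) (u0 : F) (k : F) (kr : F) (ur : F) t)).prod f) := by
  induction n with
  | zero => intro _; simpa using h0
  | succ n ih =>
    intro hn
    have hi := i.2
    have h1 := ih (by omega)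
    have h2 := St.inv (qh := qh) (k0 := k0) (u0 := u0) (k := k) (kr := kr) (ur := ur) (t := t)
      hr hO (⟨n, by omega⟩ : Fin r) ⟨n + 1, by omega⟩ rfl (Fin.lt_def.2 (by simp; omega)) h1
    rw [mul_assoc, ← prod_ins (fun b : Fin r => (b : ℕ) < n) (fun b : Fin r => (b : ℕ) < n + 1)
      (fun b => k ^ (eta (y b - y i))) _
      (fun b => by rw [Fin.ext_iff]; dsimp only; omega) (by simp)] at h2
    rw [List.range_succ, List.map_append, List.reverse_append]
    simpa using h2

theorem coeff_eq (k0 u0 k kr ur Θ : Fˣ) (y : E r) (i : Fin r) (n : ℕ) (hn : (i : ℕ) + n + 1 = r) :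
    1 * (∏ b : Fin r, if (i : ℕ) < b ∧ (b : ℕ) ≤ i + n then k ^ (-eta (y i - y b)) else 1)
      * (kr ^ (-etaE (2 * y i)) * ur ^ (-etaO (2 * y i)))
      * (∏ b : Fin r, if b ≠ i ∧ rho i b < r - 1 then k ^ (-eta (y b + y i)) else 1)
      * (k0 ^ (-etaE (2 * y i)) * u0 ^ (-etaO (2 * y i)) * Θ⁻¹)
      * (∏ b : Fin r, if (b : ℕ) < i then k ^ (eta (y b - y i)) else 1)
    = (sfrak F r k0 u0 k kr ur y i)⁻¹ * Θ⁻¹ := by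
  have h : (∏ b : Fin r, if (i : ℕ) < b ∧ (b : ℕ) ≤ i + n then k ^ (-eta (y i - y b)) else 1)
      * (∏ b : Fin r, if b ≠ i ∧ rho i b < r - 1 then k ^ (-eta (y b + y i)) else 1)
      * (∏ b : Fin r, if (b : ℕ) < i then k ^ (eta (y b - y i)) else 1)
      = (k ^ nO r y i)⁻¹ := by
    rw [nO_eq, ← zpow_neg, ← Finset.sum_neg_distrib, ← Finset.prod_mul_distrib,
      ← Finset.prod_mul_distrib]
    have hz : ∀ (s : Finset (Fin r)) (e : Fin r → ℤ), k ^ (∑ b ∈ s, e b) = ∏ b ∈ s, k ^ e b := by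
      intro s e
      induction s using Finset.induction_on with
      | empty => simp
      | insert a s ha ih => rw [Finset.sum_insert ha, Finset.prod_insert ha, zpow_add, ih]
    rw [hz]
    apply Finset.prod_congr rfl
    intro b _
    have hb := b.2
    have hi := i.2
    rcases lt_trichotomy i b with h | h | h
    · have h' : (i : ℕ) < b := h
      rw [if_pos (by omega), if_pos ⟨h.ne', by simp only [rho]; split_ifs <;> omega⟩,
        if_neg (by omega), psi, if_pos h, mul_one, ← zpow_add, add_comm (y b)]
      congr 1; ring
    · subst h
      simp [psi]
    · have h' : (b : ℕ) < i := h
      rw [if_neg (by omega), if_pos ⟨h.ne, by simp only [rho]; split_ifs <;> omega⟩,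
        if_pos h', psi, if_neg h.asymm, if_pos h, one_mul, ← zpow_add]
      congr 1; ring
  rw [sfrak, mul_inv, ← h, mul_inv, ← zpow_neg, ← zpow_neg, mul_zpow, mul_zpow]
  generalize (∏ b : Fin r, if (i : ℕ) < b ∧ (b : ℕ) ≤ i + n then k ^ (-eta (y i - y b)) else 1) = A
  generalize (∏ b : Fin r, if b ≠ i ∧ rho i b < r - 1 then k ^ (-eta (y b + y i)) else 1) = B
  generalize (∏ b : Fin r, if (b : ℕ) < i then k ^ (eta (y b - y i)) else 1) = D
  rw [one_mul]
  ac_rfl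

theorem main_fin (hr : 2 ≤ r) (hO : IsOrbit r O) (ht : t ∈ TOset F r qh O) (hy : y ∈ O)
    (i : Fin r) :
    Yop F r qh (k0 : F) (u0 : F) (k : F) (kr : F) (ur : F) t (i + 1) (X F r y)
          - ((gammaO F r qh k0 u0 k kr ur O t (i + 1) y : Fˣ) : F) • X F r y
        ∈ ltSpan F r y := by
  have s0 : St O y i i 1 True (1 : Fˣ) (X F r y) :=
    ⟨fun y => y, Stage.start i, fun _ _ h => h, by simp⟩
  have hi := i.2
  obtain ⟨n, hn⟩ : ∃ n, (i : ℕ) + n + 1 = r := ⟨r - 1 - i, by omega⟩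
  have s1 := up_chain (qh := qh) (k0 := k0) (u0 := u0) (k := k) (kr := kr) (ur := ur) (t := t)
    hr hO s0 n hn.le
  rw [show (i : ℕ) + n = r - 1 by omega] at s1
  have s2 := St.last (qh := qh) (k0 := k0) (u0 := u0) (k := k) (kr := kr) (ur := ur) (t := t)
    hr hO s1
  have s3 := down_chain (qh := qh) (k0 := k0) (u0 := u0) (k := k) (kr := kr) (ur := ur) (t := t)
    hr hO (r - 1) (by omega) _ _ s2
  have s4 := St.first (qh := qh) (k0 := k0) (u0 := u0) (k := k) (kr := kr) (ur := ur) (t := t)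
    hr hO ht hy s3
  have s5 := inv_chain (qh := qh) (k0 := k0) (u0 := u0) (k := k) (kr := kr) (ur := ur) (t := t)
    hr hO s4 i le_rfl
  have hc := coeff_eq k0 u0 k kr ur (Th F r qh t y i) y i n hn
  rw [show (i : ℕ) + n = r - 1 by omega] at hc
  rw [hc, ← gammaO_eq hr hO k0 u0 k kr ur hy] at s5
  obtain ⟨w, hw, -, hf⟩ := s5
  rw [hw.eq_self] at hf
  have hY : Yop F r qh (k0 : F) (u0 : F) (k : F) (kr : F) (ur : F) t (i + 1) (X F r y) =
      (((List.range i).map (· + 1)).reverse.map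
        (TfullInv F r qh (k0 : F) (u0 : F) (k : F) (kr : F) (ur : F) t)).prod
      (Tfull F r qh (k0 : F) (u0 : F) (k : F) (kr : F) (ur : F) t 0
        ((((List.range (r - 1)).map (· + 1)).map
          (Tfull F r qh (k0 : F) (u0 : F) (k : F) (kr : F) (ur : F) t)).prod
        (Tfull F r qh (k0 : F) (u0 : F) (k : F) (kr : F) (ur : F) t r
          ((((List.range n).map fun m => r - 1 - m).map
            (Tfull F r qh (k0 : F) (u0 : F) (k : F) (kr : F) (ur : F) t)).prod (X F r y))))) := by
    rw [Yop, Ylist, show r - ((i : ℕ) + 1) = n by omega, Nat.add_sub_cancel, List.map_cons,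
      List.map_append, List.map_append, List.prod_cons, List.prod_append, List.prod_append,
      List.map_singleton, List.prod_singleton]
    simp only [Module.End.mul_apply]
  rw [hY]
  refine (Submodule.span_le.2 ?_ : LS F (cpt r O) w y ≤ ltSpan F r y) hf
  rintro p ⟨y', h', rfl⟩
  rw [hw.eq_self]
  exact Submodule.subset_span ⟨y', (Plt.qlt hr hO hy h').2, rfl⟩

end stages

/-- Triangularity of the operators `Y_i^𝒪`:
`Y_i^𝒪(x^y)` is a quasi-polynomial of degree `y` with leading coefficient
`γ_i^𝒪(y) = ((g_y(𝔰^𝒪 t))_i)⁻¹`. -/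
theorem statement7 (F : Type*) [Field F] [CharZero F] (r : ℕ) (hr : 2 ≤ r)
    (qh k0 u0 k kr ur : Fˣ) (O : Set (E r)) (hO : IsOrbit r O)
    (t : Fin r → Fˣ) (ht : t ∈ TOset F r qh O) :
    ∀ y ∈ O, ∀ i : ℕ, 1 ≤ i → i ≤ r →
      Yop F r qh (k0 : F) (u0 : F) (k : F) (kr : F) (ur : F) t i (X F r y)
          - ((gammaO F r qh k0 u0 k kr ur O t i y : Fˣ) : F) • X F r y
        ∈ ltSpan F r y := by
  intro y hy i h1 h2
  have := main_fin (F := F) (qh := qh) (k0 := k0) (u0 := u0) (k := k) (kr := kr) (ur := ur)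
    hr hO ht hy ⟨i - 1, by omega⟩
  simp only [Nat.sub_add_cancel h1] at this
  exact this

end QP

end
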